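/- Let G ≤ PL₊(I) be a subgroup generated by n elements such that the union of the supports of the elements of G is a single open interval (G is one-orbital). Then either G contains a subgroup isomorphic to Thompson's group F, or G admits a geometrically proper generating set consisting of n elements. -/

import Mathlib

open Set

/-- The unit interval `[0,1]` as a type. -/
abbrev UI : Type := ↥unitInterval

/-- Bijections of the unit interval; orientation-preserving homeomorphisms are
exactly the monotone ones among these. -/
abbrev Homeo01 : Type := Equiv.Perm UI

namespace PingPong

/-- The support of `f`. -/
def supt (f : Homeo01) : Set UI := {t | f t ≠ t}

/-- `f` is an orientation-preserving homeomorphism of `[0,1]`: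
a monotone bijection of `[0,1]` (automatically a homeomorphism). -/
def IsOPH (f : Homeo01) : Prop := Monotone ⇑f

/-- A bump function: an orientation preserving homeomorphism with exactly one
orbital, i.e. whose support is nonempty and connected. -/
def IsBump (f : Homeo01) : Prop := IsOPH f ∧ IsConnected (supt f)

/-- A positive bump function. -/
def IsPosBump (f : Homeo01) : Prop := IsBump f ∧ ∀ t ∈ supt f, t < f t

/-- The source of a positive bump `a` with marker `t`. -/
def src (a : Homeo01) (t : UI) : Set UI := {s ∈ supt a | s < t}

/-- The destination of a positive bump `a` with marker `t`. -/
def dest (a : Homeo01) (t : UI) : Set UI := {s ∈ supt a | a t ≤ s}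

/-- `m` is a marking of the collection `A` of bumps. -/
def IsMarking (A : Set Homeo01) (m : Homeo01 → UI) : Prop := ∀ a ∈ A, m a ∈ supt a

/-- The feet of a marked bump: `false` gives the source, `true` the destination. -/
def foot (a : Homeo01) (t : UI) : Bool → Set UI
  | false => src a t
  | true => dest a t

/-- The feet of the marked family `(A, m)` are pairwise disjoint. -/
def FeetDisjoint (A : Set Homeo01) (m : Homeo01 → UI) : Prop :=
  ∀ a ∈ A, ∀ b ∈ A, ∀ i j : Bool, (a, i) ≠ (b, j) →
    Disjoint (foot a (m a) i) (foot b (m b) j)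

/-- A geometrically fast collection of (positive) bumps. -/
def FastBumps (A : Set Homeo01) : Prop :=
  (∀ a ∈ A, IsPosBump a) ∧ ∃ m : Homeo01 → UI, IsMarking A m ∧ FeetDisjoint A m

/-- `t` is a left transition point of `f`. -/
def IsLeftTransition (f : Homeo01) (t : UI) : Prop :=
  t ∉ supt f ∧ ∀ ε : ℝ, 0 < ε → ∃ s ∈ supt f, t < s ∧ (s : ℝ) < (t : ℝ) + ε

/-- `t` is a right transition point of `f`. -/
def IsRightTransition (f : Homeo01) (t : UI) : Prop :=
  t ∉ supt f ∧ ∀ ε : ℝ, 0 < ε → ∃ s ∈ supt f, s < t ∧ (t : ℝ) - ε < (s : ℝ)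

/-- `t` is a transition point of `f`. -/
def IsTransition (f : Homeo01) (t : UI) : Prop :=
  IsLeftTransition f t ∨ IsRightTransition f t

/-- A geometrically proper set of homeomorphisms. -/
def GeomProper (X : Set Homeo01) : Prop :=
  (∀ f ∈ X, ∀ g ∈ X, f ≠ g → ∀ t : UI, ¬(IsLeftTransition f t ∧ IsLeftTransition g t)) ∧
  (∀ f ∈ X, ∀ g ∈ X, f ≠ g → ∀ t : UI, ¬(IsRightTransition f t ∧ IsRightTransition g t))

/-- The positive bump `a` is used in `f`. -/
def UsedIn (f a : Homeo01) : Prop :=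
  IsPosBump a ∧ (Set.EqOn ⇑f ⇑a (supt a) ∨ Set.EqOn ⇑f ⇑a⁻¹ (supt a))

/-- The set of (positive) bumps used in `X`. -/
def usedBumps (X : Set Homeo01) : Set Homeo01 := {a | ∃ f ∈ X, UsedIn f a}

/-- A geometrically fast set of homeomorphisms. -/
def GeomFast (X : Set Homeo01) : Prop := GeomProper X ∧ FastBumps (usedBumps X)

/-- The set of transition points of elements of `X`. -/
def transitionPoints (X : Set Homeo01) : Set UI := {t | ∃ f ∈ X, IsTransition f t}

/-! ### Words -/

/-- A word in the alphabet `A^± = A ∪ A⁻¹`, recorded as a list of the permutations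
represented by its symbols (for a set `A` of positive bumps this is faithful,
since `A ∩ A⁻¹ = ∅`). -/
def WordOn (A : Set Homeo01) (w : List Homeo01) : Prop := ∀ x ∈ w, x ∈ A ∨ x⁻¹ ∈ A

/-- A freely reduced word: no symbol is immediately followed by its inverse. -/
def FreelyReduced (w : List Homeo01) : Prop := List.Chain' (fun a b => b ≠ a⁻¹) w

/-- The right action of a word on a point: apply the symbols from left to right. -/
def act (t : UI) (w : List Homeo01) : UI := w.foldl (fun s a => a s) t

/-- `w` is locally reduced at `t`. -/
def LocallyReducedAt (w : List Homeo01) (t : UI) : Prop :=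
  FreelyReduced w ∧ ∀ (u : List Homeo01) (a : Homeo01), u ++ [a] <+: w → a (act t u) ≠ act t u

open Classical in
/-- The source of a symbol of `A^±`: for `a ∈ A` it is `src a`, and for the
formal inverse of an element of `A` it is the destination of that element. -/
noncomputable def symSrc (A : Set Homeo01) (m : Homeo01 → UI) (b : Homeo01) : Set UI :=
  if b ∈ A then src b (m b) else dest b⁻¹ (m b⁻¹)

open Classical in
/-- The destination of a symbol of `A^±`. -/
noncomputable def symDest (A : Set Homeo01) (m : Homeo01 → UI) (b : Homeo01) : Set UI :=
  if b ∈ A then dest b (m b) else src b⁻¹ (m b⁻¹)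

/-- The source of a word: the source of its first symbol (empty for the empty word). -/
noncomputable def wordSrc (A : Set Homeo01) (m : Homeo01 → UI) : List Homeo01 → Set UI
  | [] => ∅
  | a :: _ => symSrc A m a

/-- The destination of a word: the destination of its last symbol. -/
noncomputable def wordDest (A : Set Homeo01) (m : Homeo01 → UI) (w : List Homeo01) : Set UI :=
  match w.getLast? with
  | none => ∅
  | some a => symDest A m a

/-- `J(w) = supt(a) \ src(a)` where `a` is the first symbol of `w`. -/
noncomputable def Jset (A : Set Homeo01) (m : Homeo01 → UI) : List Homeo01 → Set UI
  | [] => ∅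
  | a :: _ => supt a \ symSrc A m a

/-- `t` has trivial history: it lies in no foot of any element of `A`. -/
def TrivialHistory (A : Set Homeo01) (m : Homeo01 → UI) (t : UI) : Prop :=
  ∀ a ∈ A, t ∉ src a (m a) ∧ t ∉ dest a (m a)

/-- `x` has finite history: there is a finite bound on the lengths of `A`-words
locally reduced at `x` whose evaluation at `x` is outside their destination. -/
def FiniteHistory (A : Set Homeo01) (m : Homeo01 → UI) (x : UI) : Prop :=
  ∃ n : ℕ, ∀ w : List Homeo01, WordOn A w → LocallyReducedAt w x →
    act x w ∉ wordDest A m w → w.length ≤ n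

/-- A return word for `x`. -/
def IsReturnWord (x : UI) (w : List Homeo01) : Prop := w ≠ [] ∧ act x w = x

/-- `w` has a return prefix for `x`. -/
def HasReturnPrefix (x : UI) (w : List Homeo01) : Prop :=
  ∃ v : List Homeo01, v <+: w ∧ IsReturnWord x v

/-- The set of initial markers of the marked family `(A, m)`. -/
def initialMarkers (A : Set Homeo01) (m : Homeo01 → UI) : Set UI :=
  {t | (∃ a ∈ A, m a = t) ∧ ∀ b ∈ A, m b < t → b (m b) ≠ t}

/-- `M⟨X⟩`: the orbit of the set of initial markers of `(A, m)` under the group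
generated by `X`. -/
def MOrbit (A : Set Homeo01) (m : Homeo01 → UI) (X : Set Homeo01) : Set UI :=
  {u | ∃ t ∈ initialMarkers A m, ∃ g ∈ Subgroup.closure X, g t = u}

end PingPong
namespace PingPong

/-! ### Piecewise linear maps and Thompson's group F -/

/-- `f` is piecewise linear (finitely many affine pieces). -/
def IsPL (f : Homeo01) : Prop :=
  ∃ (n : ℕ) (t : Fin (n + 1) → ℝ), StrictMono t ∧ t 0 = 0 ∧ t (Fin.last n) = 1 ∧
    ∀ i : Fin n, ∃ c d : ℝ, ∀ s : UI,
      t i.castSucc ≤ (s : ℝ) → (s : ℝ) ≤ t i.succ → ((f s : ℝ)) = c * (s : ℝ) + d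

/-- `x` is a dyadic rational. -/
def IsDyadic (x : ℝ) : Prop := ∃ (a : ℤ) (k : ℕ), x = (a : ℝ) / 2 ^ k

/-- `f` belongs to Thompson's group `F`: an orientation-preserving piecewise linear
homeomorphism of `[0,1]` with dyadic breakpoints and slopes integer powers of `2`. -/
def InThompsonF (f : Homeo01) : Prop :=
  IsOPH f ∧
  ∃ (n : ℕ) (t : Fin (n + 1) → ℝ), StrictMono t ∧ t 0 = 0 ∧ t (Fin.last n) = 1 ∧
    (∀ i, IsDyadic (t i)) ∧
    ∀ i : Fin n, ∃ (k : ℤ) (d : ℝ), ∀ s : UI,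
      t i.castSucc ≤ (s : ℝ) → (s : ℝ) ≤ t i.succ → ((f s : ℝ)) = (2 : ℝ) ^ k * (s : ℝ) + d

/-! ### Stretched transition chains -/

/-- `a` is isolated in `A`: its support contains no transition point of an element of `A`. -/
def IsolatedIn (A : Set Homeo01) (a : Homeo01) : Prop :=
  ∀ t ∈ supt a, ∀ b ∈ A, ¬ IsTransition b t

/-- `c` (with supports `(x i, y i)`) is a stretched transition chain of `A`. -/
def IsSTC (A : Set Homeo01) (k : ℕ) (c : Fin (k + 1) → Homeo01)
    (x y : Fin (k + 1) → ℝ) : Prop :=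
  (∀ i, c i ∈ A ∧ ¬ IsolatedIn A (c i)) ∧
  (∀ i, supt (c i) = {t : UI | x i < (t : ℝ) ∧ (t : ℝ) < y i}) ∧
  (∀ i : Fin k, x i.castSucc < x i.succ ∧ x i.succ < y i.castSucc ∧ y i.castSucc < y i.succ) ∧
  (∀ i : Fin k, ∀ t : UI, x i.succ < (t : ℝ) → (t : ℝ) < y i.castSucc →
    ∀ b ∈ A, ¬ IsTransition b t)

/-- `S` is the underlying set of some stretched transition chain of `A`. -/
def ChainSet (A : Set Homeo01) (S : Set Homeo01) : Prop :=
  ∃ (k : ℕ) (c : Fin (k + 1) → Homeo01) (x y : Fin (k + 1) → ℝ),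
    IsSTC A k c x y ∧ S = Set.range c

/-- `S` is the underlying set of a maximal stretched transition chain of `A`. -/
def MaxChainSet (A : Set Homeo01) (S : Set Homeo01) : Prop :=
  ChainSet A S ∧ ∀ S' : Set Homeo01, ChainSet A S' → S ⊆ S' → S = S'

/-- The transition points of `A` lying in the support of the chain `c`. -/
def chainTrans (A : Set Homeo01) (k : ℕ) (c : Fin (k + 1) → Homeo01) : Set UI :=
  {t | (∃ i, t ∈ supt (c i)) ∧ ∃ b ∈ A, IsTransition b t}

/-- The image of `t` under the composition `∏ C = c 0 ⋯ c k`. -/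
def chainApply (k : ℕ) (c : Fin (k + 1) → Homeo01) (t : UI) : UI :=
  (List.ofFn c).foldl (fun s a => a s) t

/-! ### Dynamical diagrams -/

/-- The collection of feet of the bumps used in `X`, with marking `m`. -/
def Feet (X : Set Homeo01) (m : Homeo01 → UI) : Set (Set UI) :=
  {S | ∃ a ∈ usedBumps X, S = src a (m a) ∨ S = dest a (m a)}

/-- The signed bumps of `f`: bumps agreeing with `f` on their support. -/
def signedBumps (f : Homeo01) : Set Homeo01 :=
  {b | IsBump b ∧ Set.EqOn ⇑b ⇑f (supt b)}

open Classical in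
/-- The source of a signed bump, with respect to the marking `m` of the positive bumps. -/
noncomputable def sSrc (m : Homeo01 → UI) (b : Homeo01) : Set UI :=
  if IsPosBump b then src b (m b) else dest b⁻¹ (m b⁻¹)

open Classical in
/-- The destination of a signed bump, with respect to the marking `m` of the positive bumps. -/
noncomputable def sDest (m : Homeo01 → UI) (b : Homeo01) : Set UI :=
  if IsPosBump b then dest b (m b) else src b⁻¹ (m b⁻¹)

/-- An isomorphism of the dynamical diagrams of the marked families `(X, mX)` and
`(Y, mY)`, inducing the bijection `τ : X → Y`: an order-preserving bijection `Φ`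
between the collections of feet, together with, for each `f ∈ X`, a bijection of the
signed bumps of `f` with those of `τ f` under which `Φ` matches sources with sources
and destinations with destinations. -/
def DiagIso (X : Set Homeo01) (mX : Homeo01 → UI) (Y : Set Homeo01) (mY : Homeo01 → UI)
    (τ : Homeo01 → Homeo01) : Prop :=
  Set.BijOn τ X Y ∧
  ∃ Φ : Set UI → Set UI,
    Set.BijOn Φ (Feet X mX) (Feet Y mY) ∧
    (∀ S ∈ Feet X mX, ∀ T ∈ Feet X mX,
      (∀ s ∈ S, ∀ t ∈ T, s < t) → ∀ s ∈ Φ S, ∀ t ∈ Φ T, s < t) ∧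
    ∀ f ∈ X, ∃ β : Homeo01 → Homeo01,
      Set.BijOn β (signedBumps f) (signedBumps (τ f)) ∧
      ∀ b ∈ signedBumps f, Φ (sSrc mX b) = sSrc mY (β b) ∧ Φ (sDest mX b) = sDest mY (β b)

/-! ### Excision -/

/-- The union of the supports of the bumps of `E` used in `f`. -/
def quotSupp (f : Homeo01) (E : Set Homeo01) : Set UI :=
  {t | ∃ a ∈ E, UsedIn f a ∧ t ∈ supt a}

/-- `g = f/E`: `g` is the identity on the supports of the bumps of `E` used in `f`,
and agrees with `f` elsewhere. -/
def IsQuot (f : Homeo01) (E : Set Homeo01) (g : Homeo01) : Prop :=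
  (∀ t ∈ quotSupp f E, g t = t) ∧ ∀ t ∉ quotSupp f E, g t = f t

/-- `E` is extraneous in `X` (with respect to the marking `m`), witnessed by an
interval `J`. -/
def Extraneous (X : Set Homeo01) (m : Homeo01 → UI) (E : Set Homeo01) : Prop :=
  ∃ J : Set UI, J.OrdConnected ∧ ∃ f ∈ X,
    (∀ e ∈ E, UsedIn f e ∧ IsolatedIn (usedBumps X) e ∧ supt e ⊆ J) ∧
    (∃ a : Homeo01, UsedIn f a ∧ a ∉ E ∧ (src a (m a) ⊆ J ∨ dest a (m a) ⊆ J)) ∧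
    ∀ g ∈ X, g ≠ f → ∀ b : Homeo01, UsedIn g b →
      Disjoint (src b (m b)) J ∧ Disjoint (dest b (m b)) J

end PingPong
namespace PingPong

/-! ### Sequences satisfying Thompson's relations -/

/-- The relations of the infinite presentation of Thompson's group `F`. -/
def ThompsonSeq {Γ : Type*} [Group Γ] (x : ℕ → Γ) : Prop :=
  ∀ i j, i < j → x j * x i = x i * x (j + 1)

/-- The value of a positive word. -/
def wordProd {Γ : Type*} [Group Γ] (x : ℕ → Γ) (l : List ℕ) : Γ := (l.map x).prod

section ThompsonSeq

variable {Γ : Type*} [Group Γ] {x : ℕ → Γ}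

@[simp] lemma wordProd_nil : wordProd x [] = 1 := rfl

@[simp] lemma wordProd_cons (i : ℕ) (l : List ℕ) :
    wordProd x (i :: l) = x i * wordProd x l := by simp [wordProd]

@[simp] lemma wordProd_append (l m : List ℕ) :
    wordProd x (l ++ m) = wordProd x l * wordProd x m := by simp [wordProd]

lemma map_wordProd {Γ' : Type*} [Group Γ'] (π : Γ →* Γ') (l : List ℕ) :
    π (wordProd x l) = wordProd (fun i => π (x i)) l := by
  induction l with
  | nil => simp
  | cons i l ih => simp [ih]

lemma ThompsonSeq.conj (hx : ThompsonSeq x) {i j : ℕ} (h : i < j) :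
    (x i)⁻¹ * x j * x i = x (j + 1) := by
  rw [mul_assoc, hx i j h, inv_mul_cancel_left]

lemma ThompsonSeq.mul_pow (hx : ThompsonSeq x) {i j : ℕ} (h : i < j) (e : ℕ) :
    x j * x i ^ e = x i ^ e * x (j + e) := by
  induction e with
  | zero => simp
  | succ e ih =>
    rw [pow_succ, ← mul_assoc, ih, mul_assoc, hx i (j + e) (by omega), mul_assoc, add_assoc]

lemma ThompsonSeq.inv_mul_wordProd (hx : ThompsonSeq x) (l : List ℕ) :
    ∀ i, ∃ l' m', (x i)⁻¹ * wordProd x l = wordProd x l' * (wordProd x m')⁻¹ := by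
  induction l with
  | nil => exact fun i => ⟨[], [i], by simp⟩
  | cons j l ih =>
    intro i
    rcases lt_trichotomy i j with h | rfl | h
    · obtain ⟨l', m', e⟩ := ih i
      refine ⟨(j + 1) :: l', m', ?_⟩
      rw [wordProd_cons, wordProd_cons, mul_assoc, ← e, ← hx.conj h]
      group
    · exact ⟨l, [], by simp⟩
    · obtain ⟨l', m', e⟩ := ih (i + 1)
      refine ⟨j :: l', m', ?_⟩
      rw [wordProd_cons, wordProd_cons, mul_assoc, ← e, ← hx.conj h]
      group

lemma ThompsonSeq.exists_fraction (hx : ThompsonSeq x) {g : Γ}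
    (hg : g ∈ Subgroup.closure (range x)) :
    ∃ l m, g = wordProd x l * (wordProd x m)⁻¹ := by
  induction hg using Subgroup.closure_induction_left with
  | one => exact ⟨[], [], by simp⟩
  | mul_left a ha b _ ih =>
    obtain ⟨i, rfl⟩ := ha
    obtain ⟨l, m, rfl⟩ := ih
    exact ⟨i :: l, m, by simp [mul_assoc]⟩
  | inv_mul_cancel a ha b _ ih =>
    obtain ⟨i, rfl⟩ := ha
    obtain ⟨l, m, rfl⟩ := ih
    obtain ⟨l', m', e⟩ := hx.inv_mul_wordProd l i
    exact ⟨l', m ++ m', by rw [← mul_assoc, e]; simp [mul_assoc]⟩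

/-- Collecting the occurrences of the smallest letter of a positive word on the left. -/
lemma ThompsonSeq.exists_collect (hx : ThompsonSeq x) (i : ℕ) (l : List ℕ) (hl : ∀ j ∈ l, i ≤ j) :
    ∃ e l', wordProd x l = x i ^ e * wordProd x l' ∧ (∀ j ∈ l', i < j) ∧
      l.length = e + l'.length ∧ (i ∈ l → 1 ≤ e) := by
  induction l with
  | nil => exact ⟨0, [], by simp⟩
  | cons j l ih =>
    obtain ⟨e, l', h1, h2, h3, h4⟩ := ih fun k hk => hl k (by simp [hk])
    rcases (hl j (by simp)).eq_or_lt with rfl | h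
    · exact ⟨e + 1, l', by rw [wordProd_cons, h1, pow_succ', mul_assoc], h2,
        by simp [h3]; omega, by omega⟩
    · refine ⟨e, (j + e) :: l', ?_, ?_, by simp [h3]; omega, ?_⟩
      · rw [wordProd_cons, h1, ← mul_assoc, hx.mul_pow h, wordProd_cons, mul_assoc]
      · intro k hk
        rcases List.mem_cons.1 hk with rfl | hk
        · omega
        · exact h2 k hk
      · intro hi
        rcases List.mem_cons.1 hi with rfl | hi
        · omega
        · exact h4 hi

lemma ThompsonSeq.conj_mem (hx : ThompsonSeq x) {i j : ℕ} (hij : i ≤ j) {g : Γ}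
    (hg : g ∈ Subgroup.closure (x '' Ioi j)) :
    (x i)⁻¹ * g * x i ∈ Subgroup.closure (x '' Ioi (j + 1)) ∧
      (x i)⁻¹ * g * x i = (x j)⁻¹ * g * x j := by
  induction hg using Subgroup.closure_induction with
  | mem a ha =>
    obtain ⟨k, hk, rfl⟩ := ha
    have hk' : j < k := hk
    rw [hx.conj (hij.trans_lt hk'), hx.conj hk']
    exact ⟨Subgroup.subset_closure ⟨k + 1, by simpa using hk', rfl⟩, rfl⟩
  | one => simp [one_mem]
  | mul a b _ _ ha hb =>
    have e : ∀ c : Γ, c⁻¹ * (a * b) * c = (c⁻¹ * a * c) * (c⁻¹ * b * c) := fun c => by group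
    rw [e, e, ← ha.2, ← hb.2]
    exact ⟨mul_mem ha.1 hb.1, rfl⟩
  | inv a _ ha =>
    have e : ∀ c : Γ, c⁻¹ * a⁻¹ * c = (c⁻¹ * a * c)⁻¹ := fun c => by group
    rw [e, e, ← ha.2]
    exact ⟨inv_mem ha.1, rfl⟩

lemma ThompsonSeq.eq_of_pow_mem (hx : ThompsonSeq x) {i e : ℕ} (he : 1 ≤ e)
    (h : x i ^ e ∈ Subgroup.closure (x '' Ioi i)) : x 1 = x 2 := by
  have h1 := (hx.conj_mem le_rfl h).1
  have h0 : (x i)⁻¹ * x i ^ e * x i = x i ^ e := by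
    rw [mul_assoc, ← pow_succ, pow_succ', inv_mul_cancel_left]
  rw [h0] at h1
  have h2 := (hx.conj_mem (Nat.le_succ i) h1).2
  rw [h0] at h2
  have h3 : x (i + 1) = x (i + 1 + e) := by
    have := hx.mul_pow (Nat.lt_succ_self i) e
    have h4 : x (i + 1) * x i ^ e = x i ^ e * x (i + 1) := by
      rw [h2, Nat.succ_eq_add_one]
      nth_rewrite 2 [← h2]
      group
    rw [Nat.succ_eq_add_one, h4] at this
    exact mul_left_cancel this
  have step : ∀ k, x (k + 1) = x (k + 1 + e) ↔ x (k + 2) = x (k + 2 + e) := by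
    intro k
    rw [← hx.conj (show 0 < k + 1 by omega), show k + 2 + e = k + 1 + e + 1 by omega,
      ← hx.conj (show 0 < k + 1 + e by omega)]
    simp
  have all : ∀ k, x (k + 1) = x (k + 1 + e) ↔ x 1 = x (1 + e) := by
    intro k
    induction k with
    | zero => simp
    | succ k ih => rw [← ih]; exact (step k).symm
  have e1 : x 1 = x (1 + e) := (all i).1 h3
  have e2 : x 2 = x (2 + e) := (all 1).2 e1
  have := hx.conj (show 1 < 1 + e by omega)
  rw [← e1, show 1 + e + 1 = 2 + e by omega, ← e2] at this
  simpa using this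

lemma wordProd_mem {s : Set ℕ} {l : List ℕ} (hl : ∀ j ∈ l, j ∈ s) :
    wordProd x l ∈ Subgroup.closure (x '' s) := by
  refine Subgroup.list_prod_mem _ fun a ha => ?_
  obtain ⟨j, hj, rfl⟩ := List.mem_map.1 ha
  exact Subgroup.subset_closure ⟨j, hl j hj, rfl⟩

/-- A homomorphism which does not identify `x 1` and `x 2` is injective on the group generated
by a sequence satisfying Thompson's relations. -/
lemma ThompsonSeq.eq_one_of_map (hx : ThompsonSeq x) {Γ' : Type*} [Group Γ'] (π : Γ →* Γ')
    (hπ : π (x 1) ≠ π (x 2)) {g : Γ} (hg : g ∈ Subgroup.closure (range x)) (h : π g = 1) :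
    g = 1 := by
  have hy : ThompsonSeq fun i => π (x i) := fun i j hij => by
    simp only [← map_mul, hx i j hij]
  have key : ∀ i e e' l m, (∀ j ∈ l, i < j) → (∀ j ∈ m, i < j) → e' < e →
      π (x i ^ e * wordProd x l) ≠ π (x i ^ e' * wordProd x m) := by
    intro i e e' l m hl hm hlt heq
    obtain ⟨d, rfl⟩ := Nat.exists_eq_add_of_lt hlt
    refine hπ (hy.eq_of_pow_mem (i := i) (e := d + 1) (by omega) ?_)
    have : π (x i) ^ (d + 1) = wordProd (fun i => π (x i)) m * (wordProd (fun i => π (x i)) l)⁻¹ := by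
      rw [map_mul, map_mul, map_wordProd, map_wordProd, map_pow, map_pow, add_assoc, pow_add,
        mul_assoc] at heq
      rw [← mul_left_cancel heq]
      group
    rw [this]
    exact mul_mem (wordProd_mem hm) (inv_mem (wordProd_mem hl))
  have main : ∀ k l m, l.length + m.length = k → π (wordProd x l) = π (wordProd x m) →
      wordProd x l = wordProd x m := by
    intro k
    induction k using Nat.strong_induction_on with
    | _ k ih =>
      intro l m hk heq
      by_cases hne : l ++ m = []
      · obtain ⟨rfl, rfl⟩ := List.append_eq_nil_iff.1 hne
        rfl
      obtain ⟨i, hi, hmin⟩ : ∃ i ∈ l ++ m, ∀ j ∈ l ++ m, i ≤ j := by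
        obtain ⟨i, hi, h⟩ := (l ++ m).toFinset.exists_min_image id
          (by simpa [Finset.nonempty_iff_ne_empty] using hne)
        exact ⟨i, by simpa using hi, fun j hj => h j (by simpa using hj)⟩
      obtain ⟨e, l', h1, h2, h3, h4⟩ := hx.exists_collect i l fun j hj => hmin j (by simp [hj])
      obtain ⟨e', m', h1', h2', h3', h4'⟩ :=
        hx.exists_collect i m fun j hj => hmin j (by simp [hj])
      rw [h1, h1'] at heq ⊢
      rcases lt_trichotomy e e' with hlt | rfl | hlt
      · exact (key i e' e m' l' h2' h2 hlt heq.symm).elim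
      · have : 1 ≤ e := by
          rcases List.mem_append.1 hi with hi | hi
          · exact h4 hi
          · exact h4' hi
        rw [ih (l'.length + m'.length) (by omega) l' m' rfl]
        rw [map_mul, map_mul] at heq
        exact mul_left_cancel heq
      · exact (key i e e' l' m' h2 h2' hlt heq).elim
  obtain ⟨l, m, rfl⟩ := hx.exists_fraction hg
  rw [map_mul, map_inv, mul_inv_eq_one] at h
  rw [mul_inv_eq_one]
  exact main _ l m rfl h

/-- The sequence of generators of Thompson's group `F` built from the first two of them. -/
def seqOfPair (a b : Γ) : ℕ → Γ
  | 0 => a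
  | k + 1 => (a ^ k)⁻¹ * b * a ^ k

/-- Two elements satisfying the relations of Thompson's group `F` generate a sequence satisfying
Thompson's infinite family of relations. -/
lemma ThompsonSeq.of_commute {a b : Γ}
    (h : ∀ k, Commute (a * b⁻¹) ((a ^ (k + 1))⁻¹ * b * a ^ (k + 1))) :
    ThompsonSeq (seqOfPair a b) := by
  intro i j hij
  obtain ⟨l, rfl⟩ := Nat.exists_eq_add_of_lt hij
  cases i with
  | zero =>
    simp only [seqOfPair, zero_add, pow_succ]
    group
  | succ k =>
    have e := (h l).eq
    rw [show k + 1 + l + 1 = (l + 1 + k) + 1 by omega]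
    simp only [seqOfPair]
    rw [show l + 1 + k + 1 = l + 1 + (k + 1) by omega, pow_add a (l + 1) k,
      pow_add a (l + 1) (k + 1), pow_succ' a k]
    generalize a ^ (l + 1) = d at *
    have e' : d⁻¹ * b * d * b = b * a⁻¹ * (d⁻¹ * b * d) * a := by
      calc d⁻¹ * b * d * b = b * a⁻¹ * (a * b⁻¹ * (d⁻¹ * b * d)) * b := by group
        _ = _ := by rw [e]; group
    calc _ = (a ^ k)⁻¹ * (d⁻¹ * b * d * b) * a ^ k := by group
      _ = _ := by rw [e']; group

end ThompsonSeq

/-! ### Generators of Thompson's group `F` -/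

/-- The real function underlying the generators of `F`; it is supported on `[1 - e, 1]`. -/
noncomputable def genFun (e t : ℝ) : ℝ := min t (max ((t + (1 - e)) / 2) (max (t - e / 4) (2 * t - 1)))

lemma genFun_of_le {e t : ℝ} (_ : 0 ≤ e) (h : t ≤ 1 - e) : genFun e t = t := by
  rw [genFun, min_eq_left]
  exact le_max_of_le_left (by linarith)

lemma genFun_of_mem₁ {e t : ℝ} (h : 1 - e ≤ t) (h' : t ≤ 1 - e / 2) :
    genFun e t = (t + (1 - e)) / 2 := by
  rw [genFun, max_eq_left (max_le _ _), min_eq_right] <;> linarith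

lemma genFun_of_mem₂ {e t : ℝ} (_ : 0 ≤ e) (h : 1 - e / 2 ≤ t) (h' : t ≤ 1 - e / 4) :
    genFun e t = t - e / 4 := by
  rw [genFun, max_eq_left (b := 2 * t - 1), max_eq_right, min_eq_right] <;> linarith

lemma genFun_of_ge {e t : ℝ} (h : 1 - e / 4 ≤ t) (h' : t ≤ 1) :
    genFun e t = 2 * t - 1 := by
  rw [genFun, max_eq_right (b := 2 * t - 1), max_eq_right, min_eq_right] <;> linarith

lemma genFun_scale (e t : ℝ) : genFun (e / 2) t = (genFun e (2 * t - 1) + 1) / 2 := by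
  have h : ∀ a b : ℝ, (max a b + 1) / 2 = max ((a + 1) / 2) ((b + 1) / 2) := fun a b => by
    rcases le_total a b with h | h
    · rw [max_eq_right h, max_eq_right (by linarith)]
    · rw [max_eq_left h, max_eq_left (by linarith)]
  have h' : ∀ a b : ℝ, (min a b + 1) / 2 = min ((a + 1) / 2) ((b + 1) / 2) := fun a b => by
    rcases le_total a b with h | h
    · rw [min_eq_left h, min_eq_left (by linarith)]
    · rw [min_eq_right h, min_eq_right (by linarith)]
  rw [genFun, genFun, h', h, h]
  congr 1
  · ring
  · congr 1
    · ring
    · congr 1 <;> ring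

lemma genFun_le (e t : ℝ) : genFun e t ≤ t := min_le_left _ _

lemma genFun_relation {e e' t : ℝ} (h0 : 0 < e') (h : e' ≤ e / 2) (ht : t ≤ 1) :
    genFun e' (genFun e t) = genFun e (genFun (e' / 2) t) := by
  rcases le_total t (1 - e / 4) with h1 | h1
  · rw [genFun_of_le (e := e' / 2) (by linarith) (by linarith), genFun_of_le h0.le]
    rcases le_total t (1 - e / 2) with h2 | h2
    · exact (genFun_le e t).trans (by linarith)
    · rw [genFun_of_mem₂ (by linarith) h2 h1]
      linarith
  · rw [genFun_of_ge h1 ht, genFun_scale]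
    have h3 : genFun e' (2 * t - 1) ≤ 1 := (genFun_le _ _).trans (by linarith)
    have h4 : 1 - e / 2 ≤ genFun e' (2 * t - 1) := by
      rcases le_total (2 * t - 1) (1 - e') with h2 | h2
      · rw [genFun_of_le h0.le h2]
        linarith
      · refine le_min (by linarith) (le_max_of_le_left (by linarith))
    rw [genFun_of_ge (e := e) (t := (genFun e' (2 * t - 1) + 1) / 2) (by linarith) (by linarith)]
    ring

/-- The inverse of `genFun e`. -/
noncomputable def genInv (e t : ℝ) : ℝ :=
  max t (min (2 * t - (1 - e)) (min (t + e / 4) ((t + 1) / 2)))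

lemma genInv_genFun {e t : ℝ} (he : 0 ≤ e) (ht : t ≤ 1) : genInv e (genFun e t) = t := by
  rcases le_total t (1 - e) with h | h
  · rw [genFun_of_le he h, genInv, max_eq_left]
    exact min_le_of_left_le (by linarith)
  rcases le_total t (1 - e / 2) with h1 | h1
  · rw [genFun_of_mem₁ h h1, genInv, min_eq_left (le_min _ _), max_eq_right] <;> linarith
  rcases le_total t (1 - e / 4) with h2 | h2
  · rw [genFun_of_mem₂ he h1 h2, genInv, min_eq_left (b := (_ + 1) / 2), min_eq_right,
      max_eq_right] <;> linarith
  · rw [genFun_of_ge h2 ht, genInv, min_eq_right (b := (_ + 1) / 2), min_eq_right,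
      max_eq_right] <;> linarith

lemma genFun_genInv {e t : ℝ} (he : 0 ≤ e) (ht : t ≤ 1) : genFun e (genInv e t) = t := by
  rcases le_total t (1 - e) with h | h
  · have : genInv e t = t := by
      rw [genInv, max_eq_left]
      exact min_le_of_left_le (by linarith)
    rw [this, genFun_of_le he h]
  rcases le_total t (1 - 3 * e / 4) with h1 | h1
  · have : genInv e t = 2 * t - (1 - e) := by
      rw [genInv, min_eq_left (le_min _ _), max_eq_right] <;> linarith
    rw [this, genFun_of_mem₁] <;> linarith
  rcases le_total t (1 - e / 2) with h2 | h2
  · have : genInv e t = t + e / 4 := by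
      rw [genInv, min_eq_left (b := (_ + 1) / 2), min_eq_right, max_eq_right] <;> linarith
    rw [this, genFun_of_mem₂] <;> linarith
  · have : genInv e t = (t + 1) / 2 := by
      rw [genInv, min_eq_right (b := (_ + 1) / 2), min_eq_right, max_eq_right] <;> linarith
    rw [this, genFun_of_ge] <;> linarith

/-- The generators of Thompson's group `F`. -/
noncomputable def thompsonGen (i : ℕ) : Homeo01 where
  toFun t := ⟨genFun ((1 / 2) ^ i) t, by
    have h1 : (1 / 2 : ℝ) ^ i ≤ 1 := pow_le_one₀ (by norm_num) (by norm_num)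
    exact le_min t.2.1 (le_max_of_le_left (by linarith [t.2.1])),
    (genFun_le _ _).trans t.2.2⟩
  invFun t := ⟨genInv ((1 / 2) ^ i) t, le_max_of_le_left t.2.1,
    max_le t.2.2 (min_le_of_right_le (min_le_of_right_le (by linarith [t.2.2])))⟩
  left_inv t := Subtype.ext (genInv_genFun (by positivity) t.2.2)
  right_inv t := Subtype.ext (genFun_genInv (by positivity) t.2.2)

lemma coe_thompsonGen (i : ℕ) (t : UI) : (thompsonGen i t : ℝ) = genFun ((1 / 2) ^ i) t := rfl

lemma thompsonSeq_thompsonGen : ThompsonSeq thompsonGen := by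
  intro i j hij
  ext t
  simp only [Equiv.Perm.mul_apply, coe_thompsonGen]
  rw [genFun_relation (by positivity) _ t.2.2, pow_succ]
  · norm_num [div_eq_mul_inv]
  · obtain ⟨d, rfl⟩ := Nat.exists_eq_add_of_lt hij
    rw [pow_succ, pow_add]
    have h1 : (1 / 2 : ℝ) ^ d ≤ 1 := pow_le_one₀ (by norm_num) (by norm_num)
    have h2 : (0 : ℝ) < (1 / 2) ^ i := by positivity
    nlinarith

lemma thompsonGen_one_ne_two : thompsonGen 1 ≠ thompsonGen 2 := by
  intro h
  have := congrArg (fun g : Homeo01 => (g ⟨3 / 4, by norm_num, by norm_num⟩ : ℝ)) h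
  simp only [coe_thompsonGen] at this
  rw [genFun_of_mem₂ (by norm_num) (by norm_num) (by norm_num),
    genFun_of_le (by norm_num) (by norm_num)] at this
  norm_num at this

/-! ### Standard dyadic partitions -/

/-- `γ` maps `[a, b]` affinely onto `[a', b']`. -/
def AffineOn (γ : Homeo01) (a b a' b' : ℝ) : Prop :=
  ∀ s : UI, a ≤ s → (s : ℝ) ≤ b → ((γ s : ℝ) - a') * (b - a) = (s - a) * (b' - a')

lemma AffineOn.comp {γ δ : Homeo01} {a b a' b' a'' b'' : ℝ} (hγ : AffineOn γ a b a' b')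
    (hδ : AffineOn δ a' b' a'' b'') (h : a < b) (h' : a' < b') : AffineOn (δ * γ) a b a'' b'' := by
  intro s h1 h2
  have h3 := hγ s h1 h2
  have e1 : a' ≤ γ s := by
    by_contra! hc
    nlinarith [mul_nonneg (sub_nonneg.2 h1) (sub_nonneg.2 h'.le), mul_pos (sub_pos.2 hc) (sub_pos.2 h)]
  have e2 : (γ s : ℝ) ≤ b' := by
    by_contra! hc
    nlinarith [mul_nonneg (sub_nonneg.2 h2) (sub_nonneg.2 h'.le), mul_pos (sub_pos.2 hc) (sub_pos.2 h)]
  have h4 := hδ (γ s) e1 e2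
  rw [Equiv.Perm.mul_apply]
  have : (b' - a') ≠ 0 := by linarith
  apply mul_right_cancel₀ this
  linear_combination (b - a) * h4 + (b'' - a'') * h3

lemma AffineOn.eq {γ δ : Homeo01} {a b a' b' : ℝ} (hγ : AffineOn γ a b a' b')
    (hδ : AffineOn δ a b a' b') (h : a < b) {s : UI} (h1 : a ≤ s) (h2 : (s : ℝ) ≤ b) :
    γ s = δ s := by
  have := (hγ s h1 h2).trans (hδ s h1 h2).symm
  have := mul_right_cancel₀ (by linarith) this
  exact Subtype.ext (by linarith)

lemma exists_mem_piece (p : ℕ → ℝ) (s : ℝ) (n : ℕ) (hn : 0 < n) (h0 : p 0 ≤ s) (h1 : s ≤ p n) :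
    ∃ i < n, p i ≤ s ∧ s ≤ p (i + 1) := by
  induction n with
  | zero => omega
  | succ n ih =>
    rcases le_total (p n) s with h | h
    · exact ⟨n, by omega, h, h1⟩
    · rcases Nat.eq_zero_or_pos n with rfl | hn
      · exact ⟨0, by omega, h0, h1⟩
      · obtain ⟨i, hi, h⟩ := ih hn h
        exact ⟨i, by omega, h⟩

/-- The points `t 0, …, t n` cut `[0,1]` into standard dyadic intervals. -/
structure IsStdPartition (n : ℕ) (t : ℕ → ℝ) : Prop where
  zero : t 0 = 0
  last : t n = 1
  std : ∀ j < n, ∃ (k : ℕ) (a : ℤ), t j = a / 2 ^ k ∧ t (j + 1) = (a + 1) / 2 ^ k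

lemma IsStdPartition.lt_succ {n : ℕ} {t : ℕ → ℝ} (h : IsStdPartition n t) {j : ℕ} (hj : j < n) :
    t j < t (j + 1) := by
  obtain ⟨k, a, e1, e2⟩ := h.std j hj
  rw [e1, e2]
  gcongr
  linarith

lemma IsStdPartition.mono {n : ℕ} {t : ℕ → ℝ} (h : IsStdPartition n t) {i j : ℕ} (hij : i ≤ j)
    (hj : j ≤ n) : t i ≤ t j := by
  induction j, hij using Nat.le_induction with
  | base => rfl
  | succ j _ ih => exact (ih (by omega)).trans (h.lt_succ (by omega)).le

private lemma eq_of_odd_mul {b c : ℤ} {K k : ℕ} (hb : Odd b) (hk : k ≤ K)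
    (h : (b : ℝ) / 2 ^ K = c / 2 ^ k) : K = k ∧ b = c := by
  obtain ⟨d, rfl⟩ := Nat.exists_eq_add_of_le hk
  have h1 : (b : ℝ) = c * 2 ^ d := by
    field_simp at h
    rw [pow_add] at h
    have : (2 : ℝ) ^ k ≠ 0 := by positivity
    apply mul_right_cancel₀ this
    linear_combination h
  have h2 : b = c * 2 ^ d := by exact_mod_cast h1
  rcases Nat.eq_zero_or_pos d with rfl | hd
  · simpa using h2
  · exfalso
    rw [h2] at hb
    have : Even (c * 2 ^ d) := ((even_two).pow_of_ne_zero hd.ne').mul_left c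
    exact (Int.not_even_iff_odd.2 hb) this

/-- A nontrivial standard dyadic partition has two adjacent sibling intervals. -/
lemma IsStdPartition.exists_siblings {n : ℕ} {t : ℕ → ℝ} (h : IsStdPartition n t) (hn : 2 ≤ n) :
    ∃ j, j + 2 ≤ n ∧ ∃ (k : ℕ) (a : ℤ), t j = a / 2 ^ k ∧ t (j + 1) = (a + 1 / 2) / 2 ^ k ∧
      t (j + 2) = (a + 1) / 2 ^ k := by
  have := h.std
  choose! k a hk ha using this
  obtain ⟨j, hj, hmax⟩ := (Finset.range n).exists_max_image k ⟨0, by simp; omega⟩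
  simp only [Finset.mem_range] at hj hmax
  have hK : 1 ≤ k j := by
    by_contra! hc
    have h0 : k j = 0 := by omega
    have e1 := hk j hj
    have e2 := ha j hj
    rw [h0, pow_zero, div_one] at e1 e2
    have e3 : (0 : ℝ) ≤ t j := by rw [← h.zero]; exact h.mono (by omega) (by omega)
    have e4 : t (j + 1) ≤ 1 := by rw [← h.last]; exact h.mono (by omega) (by omega)
    have e5 : t j = 0 := by linarith
    have e6 : t (j + 1) = 1 := by linarith
    rcases Nat.eq_zero_or_pos j with rfl | hj0
    · have e7 := h.lt_succ (j := 1) (by omega)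
      have e8 := h.mono (i := 2) (j := n) (by omega) le_rfl
      rw [h.last] at e8
      norm_num at e6 e7
      linarith
    · have e7 := h.lt_succ (j := 0) (by omega)
      have e8 := h.mono (i := 1) (j := j) (by omega) (by omega)
      rw [h.zero] at e7
      norm_num at e7
      linarith
  obtain ⟨K, hKK⟩ := Nat.exists_eq_add_of_le' hK
  rcases Int.even_or_odd (a j) with he | ho
  · obtain ⟨b, hb⟩ := he
    have hodd : Odd (a j + 1) := ⟨b, by omega⟩
    have hlt : j + 1 < n := by
      by_contra! hc
      have e1 := ha j hj
      rw [show j + 1 = n by omega, h.last] at e1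
      have e2 : ((a j + 1 : ℤ) : ℝ) / 2 ^ k j = (1 : ℤ) / 2 ^ 0 := by
        push_cast; rw [← e1]; norm_num
      have := (eq_of_odd_mul hodd (by omega) e2).1
      omega
    have e3 : ((a j + 1 : ℤ) : ℝ) / 2 ^ k j = a (j + 1) / 2 ^ k (j + 1) := by
      rw [← hk (j + 1) hlt, ha j hj]; push_cast; rfl
    obtain ⟨e4, e5⟩ := eq_of_odd_mul hodd (hmax _ hlt) e3
    refine ⟨j, by omega, K, b, ?_, ?_, ?_⟩
    · rw [hk j hj, hKK, hb, pow_succ]; push_cast; field_simp; ring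
    · rw [ha j hj, hKK, hb, pow_succ]; push_cast; field_simp; ring
    · rw [ha (j + 1) hlt, ← e4, ← e5, hKK, hb, pow_succ]; push_cast; field_simp; ring
  · obtain ⟨b, hb⟩ := ho
    obtain ⟨i, rfl⟩ : ∃ i, j = i + 1 := by
      rcases j with _ | i
      · exfalso
        have e1 := hk 0 hj
        rw [h.zero] at e1
        have : (a 0 : ℝ) = 0 := by
          rcases div_eq_zero_iff.1 e1.symm with h | h
          · exact h
          · exact absurd h (by positivity)
        have : a 0 = 0 := by exact_mod_cast this
        omega
      · exact ⟨i, rfl⟩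
    have e3 : ((a (i + 1) : ℤ) : ℝ) / 2 ^ k (i + 1) = ((a i + 1 : ℤ) : ℝ) / 2 ^ k i := by
      rw [← hk (i + 1) hj]; push_cast; rw [← ha i (by omega)]
    obtain ⟨e4, e5⟩ := eq_of_odd_mul ⟨b, hb⟩ (hmax i (by omega)) e3
    refine ⟨i, by omega, K, b, ?_, ?_, ?_⟩
    · rw [hk i (by omega), ← e4, show a i = b + b by omega, hKK, pow_succ]
      push_cast; field_simp; ring
    · rw [hk (i + 1) hj, hKK, hb, pow_succ]; push_cast; field_simp
    · rw [ha (i + 1) hj, hKK, hb, pow_succ]; push_cast; field_simp; ring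

/-- The vine partition `0, 1/2, 3/4, …, 1 - 2 ^ (1 - n), 1`. -/
noncomputable def vine (n j : ℕ) : ℝ := if j < n then 1 - (1 / 2) ^ j else 1

lemma vine_lt {n j : ℕ} (h : j < n) : vine n j < vine n (j + 1) := by
  unfold vine
  have h0 : (0 : ℝ) < (1 / 2) ^ j := by positivity
  rw [if_pos h, pow_succ]
  split_ifs <;> linarith

lemma AffineOn.left_half {γ : Homeo01} {a b a' b' : ℝ} (h : AffineOn γ a b a' b') (hab : a ≤ b) :
    AffineOn γ a ((a + b) / 2) a' ((a' + b') / 2) := fun s h1 h2 => by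
  have := h s h1 (by linarith)
  linear_combination this / 2

lemma AffineOn.right_half {γ : Homeo01} {a b a' b' : ℝ} (h : AffineOn γ a b a' b') (hab : a ≤ b) :
    AffineOn γ ((a + b) / 2) b ((a' + b') / 2) b' := fun s h1 h2 => by
  have := h s (by linarith) h2
  linear_combination this / 2

/-- Elements of the group generated by `thompsonGen` realise all maps from vines to standard
dyadic partitions. -/
lemma IsStdPartition.exists_affineOn {n : ℕ} (hn : 1 ≤ n) : ∀ {t : ℕ → ℝ}, IsStdPartition n t →
    ∃ γ ∈ Subgroup.closure (range thompsonGen), ∀ i < n,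
      AffineOn γ (vine n i) (vine n (i + 1)) (t i) (t (i + 1)) := by
  induction n, hn using Nat.le_induction with
  | base =>
    intro t h
    refine ⟨1, one_mem _, fun i hi s _ _ => ?_⟩
    obtain rfl : i = 0 := by omega
    have e := h.last
    rw [zero_add, h.zero, e]
    simp [vine]
  | succ n hn ih =>
    intro t h
    obtain ⟨j, hj, k, a, e0, e1, e2⟩ := h.exists_siblings (by omega)
    set t' : ℕ → ℝ := fun i => if i ≤ j then t i else t (i + 1) with ht'
    have h' : IsStdPartition n t' := by
      refine ⟨by simp [ht', h.zero], by simp only [ht']; rw [if_neg (by omega), h.last], ?_⟩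
      intro i hi
      rcases lt_trichotomy i j with hlt | rfl | hlt
      · simp only [ht', if_pos hlt.le, if_pos (show i + 1 ≤ j by omega)]
        exact h.std i (by omega)
      · simp only [ht', le_refl, if_true, if_neg (show ¬ i + 1 ≤ i by omega)]
        exact ⟨k, a, e0, e2⟩
      · simp only [ht', if_neg (show ¬ i ≤ j by omega), if_neg (show ¬ i + 1 ≤ j by omega)]
        exact h.std (i + 1) (by omega)
    obtain ⟨γ, hγ, hA⟩ := ih h'
    have hAj := hA j (by omega)
    have tj : t' j = t j := by simp [ht']
    have tj1 : t' (j + 1) = t (j + 2) := by simp [ht']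
    have tmid : (t j + t (j + 2)) / 2 = t (j + 1) := by
      rw [e0, e1, e2]; ring
    have hlt := vine_lt (show j < n by omega)
    rw [tj, tj1] at hAj
    have hL := hAj.left_half hlt.le
    have hR := hAj.right_half hlt.le
    rw [tmid] at hL hR
    have vj : vine n j = 1 - (1 / 2) ^ j := by rw [vine, if_pos (by omega)]
    have vj' : vine (n + 1) j = 1 - (1 / 2) ^ j := by rw [vine, if_pos (by omega)]
    have vj1' : vine (n + 1) (j + 1) = 1 - (1 / 2) ^ j / 2 := by
      rw [vine, if_pos (by omega), pow_succ]; ring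
    have hpos : (0 : ℝ) < (1 / 2) ^ j := by positivity
    rcases (show j + 1 = n ∨ j + 1 < n by omega) with rfl | hjn
    · refine ⟨γ, hγ, fun i hi => ?_⟩
      have v1 : vine (j + 1) (j + 1) = 1 := by simp [vine]
      have v2 : vine (j + 1 + 1) (j + 2) = 1 := by simp [vine]
      rw [v1, vj] at hL hR
      have hm : ((1 - (1 / 2 : ℝ) ^ j) + 1) / 2 = 1 - (1 / 2) ^ j / 2 := by ring
      rw [hm] at hL hR
      rcases lt_trichotomy i j with hlt | rfl | hlt
      · have := hA i (by omega)
        simp only [ht', if_pos hlt.le, if_pos (show i + 1 ≤ j by omega)] at this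
        simp only [vine, if_pos (show i < j + 1 by omega), if_pos (show i + 1 < j + 1 by omega)]
          at this
        simpa only [vine, if_pos (show i < j + 1 + 1 by omega),
          if_pos (show i + 1 < j + 1 + 1 by omega)] using this
      · rw [vj', vj1']; exact hL
      · obtain rfl : i = j + 1 := by omega
        rw [vj1', v2]; exact hR
    · refine ⟨γ * thompsonGen j, mul_mem hγ (Subgroup.subset_closure ⟨j, rfl⟩), fun i hi => ?_⟩
      have v1 : vine n (j + 1) = 1 - (1 / 2) ^ j / 2 := by
        rw [vine, if_pos (by omega), pow_succ]; ring
      have v2 : vine (n + 1) (j + 1 + 1) = 1 - (1 / 2) ^ j / 4 := by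
        rw [vine, if_pos (by omega), pow_succ, pow_succ]; ring
      rw [v1, vj] at hL hR
      rcases (show i < j ∨ i = j ∨ i = j + 1 ∨ j + 1 < i by omega) with hlt | rfl | rfl | hlt
      · have := hA i (by omega)
        simp only [ht', if_pos hlt.le, if_pos (show i + 1 ≤ j by omega)] at this
        simp only [vine, if_pos (show i < n by omega), if_pos (show i + 1 < n by omega)]
          at this
        simp only [vine, if_pos (show i < n + 1 by omega),
          if_pos (show i + 1 < n + 1 by omega)]
        have hi1 : (1 / 2 : ℝ) ^ j ≤ (1 / 2) ^ (i + 1) :=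
          pow_le_pow_of_le_one (by norm_num) (by norm_num) (by omega)
        have hi2 : (0 : ℝ) < (1 / 2) ^ i := by positivity
        refine AffineOn.comp (a' := 1 - (1 / 2) ^ i) (b' := 1 - (1 / 2) ^ (i + 1))
          (fun s h1 h2 => ?_) this ?_ ?_
        · rw [coe_thompsonGen, genFun_of_le hpos.le (by linarith)]
        · rw [pow_succ]; linarith
        · rw [pow_succ]; linarith
      · rw [vj', vj1']
        refine AffineOn.comp (fun s h1 h2 => ?_) hL (by linarith) (by linarith)
        rw [coe_thompsonGen, genFun_of_mem₁ h1 h2]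
        ring
      · rw [vj1', v2]
        refine AffineOn.comp (fun s h1 h2 => ?_) hR (by linarith) (by linarith)
        rw [coe_thompsonGen, genFun_of_mem₂ hpos.le h1 h2]
        ring
      · obtain ⟨m, rfl⟩ : ∃ m, i = m + 1 := ⟨i - 1, by omega⟩
        have := hA m (by omega)
        simp only [ht', if_neg (show ¬ m ≤ j by omega), if_neg (show ¬ m + 1 ≤ j by omega)] at this
        refine AffineOn.comp (fun s h1 h2 => ?_) this (vine_lt hi) (vine_lt (by omega))
        have w1 : vine (n + 1) (m + 1) = (vine n m + 1) / 2 := by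
          simp only [vine, if_pos (show m + 1 < n + 1 by omega), if_pos (show m < n by omega), pow_succ]
          ring
        have w2 : vine (n + 1) (m + 1 + 1) = (vine n (m + 1) + 1) / 2 := by
          by_cases hc : m + 1 < n
          · simp only [vine, if_pos (show m + 1 + 1 < n + 1 by omega), if_pos hc, pow_succ]
            ring
          · simp only [vine, if_neg (show ¬ m + 1 + 1 < n + 1 by omega), if_neg hc]
            norm_num
        have w3 : 1 - (1 / 2) ^ j / 4 ≤ vine (n + 1) (m + 1) := by
          have hi1 : (1 / 2 : ℝ) ^ (m + 1) ≤ (1 / 2) ^ (j + 2) :=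
            pow_le_pow_of_le_one (by norm_num) (by norm_num) (by omega)
          rw [vine, if_pos (by omega)]
          rw [pow_add _ j] at hi1
          linarith
        rw [coe_thompsonGen, genFun_of_ge (by linarith) s.2.2, w1, w2]
        ring

lemma IsDyadic.add {x y : ℝ} (hx : IsDyadic x) (hy : IsDyadic y) : IsDyadic (x + y) := by
  obtain ⟨a, k, rfl⟩ := hx
  obtain ⟨b, l, rfl⟩ := hy
  refine ⟨a * 2 ^ l + b * 2 ^ k, k + l, ?_⟩
  push_cast
  rw [pow_add]
  field_simp

lemma IsDyadic.neg {x : ℝ} (hx : IsDyadic x) : IsDyadic (-x) := by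
  obtain ⟨a, k, rfl⟩ := hx
  exact ⟨-a, k, by push_cast; ring⟩

lemma IsDyadic.zpow_mul {x : ℝ} (hx : IsDyadic x) (m : ℤ) : IsDyadic ((2 : ℝ) ^ m * x) := by
  obtain ⟨a, k, rfl⟩ := hx
  obtain ⟨m, rfl | rfl⟩ := m.eq_nat_or_neg
  · exact ⟨2 ^ m * a, k, by push_cast; rw [zpow_natCast]; ring⟩
  · refine ⟨a, m + k, ?_⟩
    rw [zpow_neg, zpow_natCast, pow_add]
    field_simp

lemma IsDyadic.eventually {x : ℝ} (hx : IsDyadic x) :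
    ∀ᶠ M : ℕ in Filter.atTop, ∃ z : ℤ, x * 2 ^ M = z := by
  obtain ⟨a, k, rfl⟩ := hx
  filter_upwards [Filter.eventually_ge_atTop k] with M hM
  obtain ⟨d, rfl⟩ := Nat.exists_eq_add_of_le hM
  refine ⟨a * 2 ^ d, ?_⟩
  push_cast
  rw [pow_add]
  field_simp

lemma coe_apply_zero {g : Homeo01} (hg : IsOPH g) : (g 0 : ℝ) = 0 := by
  have h1 : g 0 ≤ g (g.symm 0) := hg (unitInterval.nonneg' (t := g.symm 0))
  rw [Equiv.apply_symm_apply] at h1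
  have h2 : g 0 = 0 := le_antisymm h1 unitInterval.nonneg'
  rw [h2]; rfl

lemma coe_apply_one {g : Homeo01} (hg : IsOPH g) : (g 1 : ℝ) = 1 := by
  have h1 : g (g.symm 1) ≤ g 1 := hg (unitInterval.le_one' (t := g.symm 1))
  rw [Equiv.apply_symm_apply] at h1
  have h2 : g 1 = 1 := le_antisymm unitInterval.le_one' h1
  rw [h2]; rfl

/-- An element of `F` maps all intervals of a fine uniform dyadic partition affinely onto
standard dyadic intervals. -/
lemma InThompsonF.exists_uniform {g : Homeo01} (hg : InThompsonF g) :
    ∃ M : ℕ, ∀ i : ℕ, i < 2 ^ M → ∃ (k : ℕ) (a : ℤ),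
      AffineOn g ((i : ℝ) / 2 ^ M) ((i + 1 : ℝ) / 2 ^ M) (a / 2 ^ k) ((a + 1) / 2 ^ k) := by
  obtain ⟨hmono, n, t, ht, ht0, ht1, hdy, hpc⟩ := hg
  choose k d hd using hpc
  have hrange : ∀ j, t j ∈ unitInterval := fun j => by
    constructor
    · rw [← ht0]; exact ht.monotone (Fin.zero_le j)
    · rw [← ht1]; exact ht.monotone (Fin.le_last j)
  have hvert : ∀ j : Fin (n + 1), IsDyadic (g ⟨t j, hrange j⟩ : ℝ) := by
    intro j
    induction j using Fin.induction with
    | zero =>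
      have : (⟨t 0, hrange 0⟩ : UI) = 0 := Subtype.ext ht0
      rw [this, coe_apply_zero hmono]
      exact ⟨0, 0, by simp⟩
    | succ j ih =>
      have hlt := ht (Fin.castSucc_lt_succ (i := j))
      have e1 := hd j ⟨_, hrange j.castSucc⟩ le_rfl hlt.le
      have e2 := hd j ⟨_, hrange j.succ⟩ hlt.le le_rfl
      have : (g ⟨t j.succ, hrange j.succ⟩ : ℝ) = (2 : ℝ) ^ k j * t j.succ +
          (g ⟨t j.castSucc, hrange j.castSucc⟩ + -((2 : ℝ) ^ k j * t j.castSucc)) := by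
        rw [e1, e2]; simp
      rw [this]
      exact ((hdy _).zpow_mul _).add (ih.add ((hdy _).zpow_mul _).neg)
  have hdd : ∀ j, IsDyadic (d j) := fun j => by
    have hlt := ht (Fin.castSucc_lt_succ (i := j))
    have e1 := hd j ⟨_, hrange j.castSucc⟩ le_rfl hlt.le
    have : d j = (g ⟨t j.castSucc, hrange j.castSucc⟩ + -((2 : ℝ) ^ k j * t j.castSucc)) := by
      rw [e1]; simp
    rw [this]
    exact (hvert _).add ((hdy _).zpow_mul _).neg
  have ev1 : ∀ᶠ M : ℕ in Filter.atTop, ∀ j, ∃ z : ℤ, t j * 2 ^ M = z :=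
    Filter.eventually_all.2 fun j => (hdy j).eventually
  have ev2 : ∀ᶠ M : ℕ in Filter.atTop, ∀ j, ∃ z : ℤ, (2 : ℝ) ^ (- k j) * d j * 2 ^ M = z :=
    Filter.eventually_all.2 fun j => ((hdd j).zpow_mul _).eventually
  have ev3 : ∀ᶠ M : ℕ in Filter.atTop, ∀ j, (k j).toNat ≤ M :=
    Filter.eventually_all.2 fun j => Filter.eventually_ge_atTop _
  obtain ⟨M, h1, h2, h3⟩ := (ev1.and (ev2.and ev3)).exists
  choose z hz using h1
  choose w hw using h2
  refine ⟨M, fun i hi => ?_⟩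
  have hM : (0 : ℝ) < 2 ^ M := by positivity
  have hi' : (i : ℝ) < 2 ^ M := by exact_mod_cast hi
  obtain ⟨j, hj1, hj2⟩ : ∃ j : Fin n, t j.castSucc ≤ (i : ℝ) / 2 ^ M ∧ (i : ℝ) / 2 ^ M < t j.succ := by
    by_contra! hc
    have : ∀ j : Fin (n + 1), t j ≤ (i : ℝ) / 2 ^ M := by
      intro j
      induction j using Fin.induction with
      | zero => rw [ht0]; positivity
      | succ j ih => exact hc j ih
    have := this (Fin.last n)
    rw [ht1, le_div_iff₀ hM] at this
    linarith
  have hj3 : ((i : ℝ) + 1) / 2 ^ M ≤ t j.succ := by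
    rw [div_lt_iff₀ hM, hz] at hj2
    have : (i : ℤ) < z j.succ := by exact_mod_cast hj2
    have : (i : ℤ) + 1 ≤ z j.succ := this
    rw [div_le_iff₀ hM, hz]
    exact_mod_cast this
  obtain ⟨l, hl⟩ : ∃ l : ℕ, (l : ℤ) = M - k j := ⟨(M - k j).toNat, by
    have := h3 j
    omega⟩
  refine ⟨l, i + w j, fun s hs1 hs2 => ?_⟩
  rw [hd j s (hj1.trans hs1) (hs2.trans hj3)]
  have e1 : (2 : ℝ) ^ l = 2 ^ M * (2 : ℝ) ^ (-k j) := by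
    rw [← zpow_natCast, hl, sub_eq_add_neg, zpow_add₀ (by norm_num), zpow_natCast]
  have e2 : (2 : ℝ) ^ k j * (2 : ℝ) ^ (-k j) = 1 := by
    rw [← zpow_add₀ (by norm_num)]; simp
  have e3 := hw j
  push_cast
  rw [← e3, e1]
  have e4 : (2 : ℝ) ^ (-k j) ≠ 0 := by positivity
  field_simp
  generalize (2 : ℝ) ^ k j = x at *
  generalize (2 : ℝ) ^ (-k j) = y at *
  linear_combination (s * 2 ^ M : ℝ) * e2

/-- Thompson's group `F` is generated by `thompsonGen`. -/
lemma InThompsonF.mem_closure {g : Homeo01} (hg : InThompsonF g) :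
    g ∈ Subgroup.closure (range thompsonGen) := by
  obtain ⟨M, hM⟩ := hg.exists_uniform
  have hmono := hg.1
  have hpos : (0 : ℝ) < 2 ^ M := by positivity
  have hn : 1 ≤ 2 ^ M := Nat.one_le_two_pow
  have hu : ∀ i : ℕ, i ≤ 2 ^ M → (i : ℝ) / 2 ^ M ∈ unitInterval := fun i hi => by
    refine ⟨by positivity, (div_le_one hpos).2 (by exact_mod_cast hi)⟩
  classical
  set t : ℕ → ℝ := fun i => if h : i ≤ 2 ^ M then g ⟨(i : ℝ) / 2 ^ M, hu i h⟩ else 0 with ht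
  have hA : ∀ i : ℕ, i < 2 ^ M → AffineOn g ((i : ℝ) / 2 ^ M) ((i + 1 : ℕ) / 2 ^ M) (t i) (t (i + 1)) ∧
      ∃ (k : ℕ) (a : ℤ), t i = a / 2 ^ k ∧ t (i + 1) = (a + 1) / 2 ^ k := by
    intro i hi
    obtain ⟨k, a, hka⟩ := hM i hi
    have hlt : (i : ℝ) / 2 ^ M < (i + 1) / 2 ^ M := by gcongr; linarith
    have e1 : t i = a / 2 ^ k := by
      simp only [ht, dif_pos hi.le]
      have := hka ⟨_, hu i hi.le⟩ le_rfl hlt.le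
      rw [sub_self, zero_mul] at this
      have := (mul_eq_zero.1 this).resolve_right (by linarith)
      linarith
    have e2 : t (i + 1) = (a + 1) / 2 ^ k := by
      simp only [ht, dif_pos (Nat.succ_le_of_lt hi)]
      have := hka ⟨_, hu (i + 1) hi⟩ (by push_cast; exact hlt.le) (by push_cast; exact le_rfl)
      push_cast at this ⊢
      have h0 : ((i : ℝ) + 1) / 2 ^ M - i / 2 ^ M ≠ 0 := by linarith
      rw [mul_comm] at this
      have := mul_left_cancel₀ h0 this
      linarith
    refine ⟨?_, k, a, e1, e2⟩
    rw [e1, e2]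
    push_cast
    exact hka
  have hS1 : IsStdPartition (2 ^ M) fun i => (i : ℝ) / 2 ^ M := by
    refine ⟨by simp, by simp, fun i hi => ⟨M, i, by simp, by push_cast; rfl⟩⟩
  have hS2 : IsStdPartition (2 ^ M) t := by
    refine ⟨?_, ?_, fun i hi => (hA i hi).2⟩
    · simp only [ht, dif_pos (Nat.zero_le _)]
      rw [show (⟨((0 : ℕ) : ℝ) / 2 ^ M, hu 0 (Nat.zero_le _)⟩ : UI) = 0 from
        Subtype.ext (by simp), coe_apply_zero hmono]
    · simp only [ht, dif_pos le_rfl]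
      rw [show (⟨((2 ^ M : ℕ) : ℝ) / 2 ^ M, hu _ le_rfl⟩ : UI) = 1 from
        Subtype.ext (by simp), coe_apply_one hmono]
  obtain ⟨γ, hγ, h1⟩ := hS1.exists_affineOn hn
  obtain ⟨δ, hδ, h2⟩ := hS2.exists_affineOn hn
  have : g = δ * γ⁻¹ := by
    rw [eq_mul_inv_iff_mul_eq]
    ext1 s
    obtain ⟨i, hi, hs1, hs2⟩ := exists_mem_piece (vine (2 ^ M)) s (2 ^ M) (by omega)
      (by simp [vine]; exact s.2.1) (by simp [vine]; exact s.2.2)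
    exact ((h1 i hi).comp (hA i hi).1 (vine_lt hi) (hS1.lt_succ hi)).eq (h2 i hi) (vine_lt hi) hs1 hs2
  rw [this]
  exact mul_mem hδ (inv_mem hγ)

/-! ### Subgroups containing Thompson's group `F` -/

/-- The group `G` contains an isomorphic copy of Thompson's group `F`. -/
def ContainsF (G : Subgroup Homeo01) : Prop :=
  ∃ φ : Homeo01 → Homeo01, Set.InjOn φ {g | InThompsonF g} ∧
    (∀ g : Homeo01, InThompsonF g → φ g ∈ G) ∧
    (∀ g h : Homeo01, InThompsonF g → InThompsonF h → φ (g * h) = φ g * φ h)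

lemma ContainsF.mono {G H : Subgroup Homeo01} (hG : ContainsF G) (h : G ≤ H) : ContainsF H := by
  obtain ⟨φ, h1, h2, h3⟩ := hG
  exact ⟨φ, h1, fun g hg => h (h2 g hg), h3⟩

lemma ThompsonSeq.containsF {y : ℕ → Homeo01} (hy : ThompsonSeq y) (hne : y 1 ≠ y 2)
    {G : Subgroup Homeo01} (hG : ∀ i, y i ∈ G) : ContainsF G := by
  classical
  set z : ℕ → Homeo01 × Homeo01 := fun i => (thompsonGen i, y i) with hz
  set Z := Subgroup.closure (range z) with hZ
  have hzs : ThompsonSeq z := fun i j hij =>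
    Prod.ext (thompsonSeq_thompsonGen i j hij) (hy i j hij)
  have left : ∀ p ∈ Z, p.1 = 1 → p = 1 := fun p hp h =>
    hzs.eq_one_of_map (MonoidHom.fst _ _) thompsonGen_one_ne_two hp h
  have right : ∀ p ∈ Z, p.2 = 1 → p = 1 := fun p hp h =>
    hzs.eq_one_of_map (MonoidHom.snd _ _) hne hp h
  have ex : ∀ g, InThompsonF g → ∃ h, (g, h) ∈ Z := by
    intro g hg
    have h1 : Subgroup.closure (range thompsonGen) = Z.map (MonoidHom.fst _ _) := by
      rw [hZ, MonoidHom.map_closure, ← range_comp]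
      rfl
    have h2 := hg.mem_closure
    rw [h1] at h2
    obtain ⟨p, hp, rfl⟩ := h2
    exact ⟨p.2, hp⟩
  have uniq : ∀ g h h', (g, h) ∈ Z → (g, h') ∈ Z → h = h' := by
    intro g h h' h1 h2
    have := left _ (mul_mem h1 (inv_mem h2)) (by simp)
    have := congrArg Prod.snd this
    simpa [mul_inv_eq_one] using this
  have ZG : ∀ p ∈ Z, p.2 ∈ G := by
    intro p hp
    have : Z ≤ G.comap (MonoidHom.snd _ _) := by
      rw [hZ, Subgroup.closure_le]
      rintro _ ⟨i, rfl⟩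
      exact hG i
    exact this hp
  refine ⟨fun g => if h : ∃ h, (g, h) ∈ Z then h.choose else 1, ?_, ?_, ?_⟩
  · intro g hg h hh e
    simp only [dif_pos (ex g hg), dif_pos (ex h hh)] at e
    have e1 := (ex g hg).choose_spec
    have e2 := (ex h hh).choose_spec
    rw [← e] at e2
    have := right _ (mul_mem e1 (inv_mem e2)) (by simp)
    have := congrArg Prod.fst this
    simpa [mul_inv_eq_one] using this
  · intro g hg
    simp only [dif_pos (ex g hg)]
    exact ZG _ (ex g hg).choose_spec
  · intro g h hg hh
    have e := mul_mem (ex g hg).choose_spec (ex h hh).choose_spec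
    have e' : ∃ k, (g * h, k) ∈ Z := ⟨_, e⟩
    simp only [dif_pos (ex g hg), dif_pos (ex h hh), dif_pos e']
    exact uniq _ _ _ e'.choose_spec e

end PingPong

namespace PingPong
open Filter Topology
open scoped Pointwise

/-! ### One-sided slopes -/

lemma eventually_nhdsGE_iff {A : UI} {p : UI → Prop} {b : UI} (hb : A < b) :
    (∀ᶠ s in 𝓝[≥] A, p s) ↔ ∃ z, A < z ∧ z < b ∧ ∀ s, A ≤ s → s ≤ z → p s := by
  constructor
  · intro h
    obtain ⟨u, ⟨h1, h2⟩, h3⟩ := (mem_nhdsGE_iff_exists_mem_Ioc_Ico_subset hb).1 h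
    obtain ⟨z, hz1, hz2⟩ := exists_between h1
    exact ⟨z, hz1, hz2.trans_le h2, fun s hs hs' => h3 ⟨hs, hs'.trans_lt hz2⟩⟩
  · rintro ⟨z, h1, -, h2⟩
    exact (mem_nhdsGE_iff_exists_mem_Ioc_Ico_subset h1).2 ⟨z, ⟨h1, le_rfl⟩, fun s hs =>
      h2 s hs.1 hs.2.le⟩

def HasRightSlope (g : Homeo01) (x : UI) (c : ℝ) : Prop :=
  ∀ᶠ s in 𝓝[≥] x, (g s : ℝ) = g x + c * (s - x)

def HasLeftSlope (g : Homeo01) (x : UI) (c : ℝ) : Prop :=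
  ∀ᶠ s in 𝓝[≤] x, (g s : ℝ) = g x + c * (s - x)

lemma inv_apply_apply (g : Homeo01) (x : UI) : g⁻¹ (g x) = x := g.symm_apply_apply x

lemma apply_inv_apply (g : Homeo01) (x : UI) : g (g⁻¹ x) = x := g.apply_symm_apply x

lemma IsOPH.strictMono {g : Homeo01} (hg : IsOPH g) : StrictMono g :=
  Monotone.strictMono_of_injective hg g.injective

lemma IsOPH.inv {g : Homeo01} (hg : IsOPH g) : IsOPH g⁻¹ := fun x y h => by
  rw [← hg.strictMono.le_iff_le]
  simpa using h

lemma IsOPH.tendsto_ge {g : Homeo01} (hg : IsOPH g) (x : UI) : Tendsto g (𝓝[≥] x) (𝓝[≥] (g x)) :=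
  (Monotone.continuous_of_surjective hg g.surjective).continuousWithinAt.tendsto_nhdsWithin
    fun _ hy => hg hy

lemma IsOPH.tendsto_le {g : Homeo01} (hg : IsOPH g) (x : UI) : Tendsto g (𝓝[≤] x) (𝓝[≤] (g x)) :=
  (Monotone.continuous_of_surjective hg g.surjective).continuousWithinAt.tendsto_nhdsWithin
    fun _ hy => hg hy

lemma HasRightSlope.mul {g h : Homeo01} {x : UI} {c d : ℝ} (hgm : IsOPH g)
    (hh : HasRightSlope h (g x) d) (hg : HasRightSlope g x c) : HasRightSlope (h * g) x (d * c) := by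
  filter_upwards [hg, (hgm.tendsto_ge x).eventually hh] with s h1 h2
  rw [Equiv.Perm.mul_apply, Equiv.Perm.mul_apply, h2, h1]; ring

lemma HasLeftSlope.mul {g h : Homeo01} {x : UI} {c d : ℝ} (hgm : IsOPH g)
    (hh : HasLeftSlope h (g x) d) (hg : HasLeftSlope g x c) : HasLeftSlope (h * g) x (d * c) := by
  filter_upwards [hg, (hgm.tendsto_le x).eventually hh] with s h1 h2
  rw [Equiv.Perm.mul_apply, Equiv.Perm.mul_apply, h2, h1]; ring

lemma HasRightSlope.inv {g : Homeo01} {x : UI} {c : ℝ} (hgm : IsOPH g) (hc : 0 < c)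
    (hg : HasRightSlope g x c) : HasRightSlope g⁻¹ (g x) c⁻¹ := by
  have ht := hgm.inv.tendsto_ge (g x)
  rw [inv_apply_apply] at ht
  filter_upwards [ht.eventually hg] with s h1
  rw [apply_inv_apply] at h1
  rw [h1, inv_apply_apply]
  field_simp
  ring

lemma HasLeftSlope.inv {g : Homeo01} {x : UI} {c : ℝ} (hgm : IsOPH g) (hc : 0 < c)
    (hg : HasLeftSlope g x c) : HasLeftSlope g⁻¹ (g x) c⁻¹ := by
  have ht := hgm.inv.tendsto_le (g x)
  rw [inv_apply_apply] at ht
  filter_upwards [ht.eventually hg] with s h1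
  rw [apply_inv_apply] at h1
  rw [h1, inv_apply_apply]
  field_simp
  ring

lemma HasRightSlope.unique {g : Homeo01} {x : UI} {c d : ℝ} (hx : x < 1)
    (h1 : HasRightSlope g x c) (h2 : HasRightSlope g x d) : c = d := by
  obtain ⟨z, hz, -, h⟩ := (eventually_nhdsGE_iff hx).1 (h1.and h2)
  have := h z hz.le le_rfl
  have hz' : (0 : ℝ) < z - x := sub_pos.2 hz
  apply mul_right_cancel₀ hz'.ne'
  linarith [this.1, this.2]

lemma hasRightSlope_one (x : UI) : HasRightSlope 1 x 1 := by
  filter_upwards with s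
  simp

lemma hasLeftSlope_one (x : UI) : HasLeftSlope 1 x 1 := by
  filter_upwards with s
  simp

/-- The group of homeomorphisms that are locally piecewise linear. -/
def PLG : Subgroup Homeo01 where
  carrier := {g | IsOPH g ∧ ∀ x, (∃ c > 0, HasRightSlope g x c) ∧ ∃ c > 0, HasLeftSlope g x c}
  mul_mem' := by
    rintro h g ⟨hm, hs⟩ ⟨gm, gs⟩
    refine ⟨hm.comp gm, fun x => ⟨?_, ?_⟩⟩
    · obtain ⟨c, hc, h1⟩ := (gs x).1
      obtain ⟨d, hd, h2⟩ := (hs (g x)).1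
      exact ⟨d * c, mul_pos hd hc, h2.mul gm h1⟩
    · obtain ⟨c, hc, h1⟩ := (gs x).2
      obtain ⟨d, hd, h2⟩ := (hs (g x)).2
      exact ⟨d * c, mul_pos hd hc, h2.mul gm h1⟩
  one_mem' := ⟨monotone_id, fun x => ⟨⟨1, one_pos, hasRightSlope_one x⟩, 1, one_pos,
    hasLeftSlope_one x⟩⟩
  inv_mem' := by
    rintro g ⟨gm, gs⟩
    refine ⟨gm.inv, fun x => ?_⟩
    obtain ⟨y, rfl⟩ := g.surjective x
    obtain ⟨⟨c, hc, h1⟩, d, hd, h2⟩ := gs y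
    exact ⟨⟨c⁻¹, inv_pos.2 hc, h1.inv gm hc⟩, d⁻¹, inv_pos.2 hd, h2.inv gm hd⟩

lemma IsPL.mem_PLG {g : Homeo01} (hm : IsOPH g) (hg : IsPL g) : g ∈ PLG := by
  obtain ⟨n, t, ht, ht0, ht1, hpc⟩ := hg
  have hrange : ∀ j, t j ∈ unitInterval := fun j => by
    constructor
    · rw [← ht0]; exact ht.monotone (Fin.zero_le j)
    · rw [← ht1]; exact ht.monotone (Fin.le_last j)
  have hslope : ∀ j : Fin n, ∃ c > 0, ∀ s r : UI, t j.castSucc ≤ s → (s : ℝ) ≤ t j.succ →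
      t j.castSucc ≤ r → (r : ℝ) ≤ t j.succ → (g s : ℝ) = g r + c * (s - r) := by
    intro j
    obtain ⟨c, d, h⟩ := hpc j
    have hlt := ht (Fin.castSucc_lt_succ (i := j))
    refine ⟨c, ?_, fun s r h1 h2 h3 h4 => by rw [h s h1 h2, h r h3 h4]; ring⟩
    have e1 := h ⟨_, hrange j.castSucc⟩ le_rfl hlt.le
    have e2 := h ⟨_, hrange j.succ⟩ hlt.le le_rfl
    have e3 : (g ⟨_, hrange j.castSucc⟩ : ℝ) < g ⟨_, hrange j.succ⟩ :=
      hm.strictMono (a := ⟨_, hrange j.castSucc⟩) (b := ⟨_, hrange j.succ⟩) hlt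
    rw [e1, e2] at e3
    simp only at e3
    nlinarith
  refine ⟨hm, fun x => ⟨?_, ?_⟩⟩
  · rcases eq_or_lt_of_le (unitInterval.le_one' (t := x)) with rfl | hx
    · refine ⟨1, one_pos, ?_⟩
      filter_upwards [self_mem_nhdsWithin] with s hs
      have : s = 1 := le_antisymm unitInterval.le_one' hs
      simp [this]
    obtain ⟨j, hj1, hj2⟩ : ∃ j : Fin n, t j.castSucc ≤ x ∧ (x : ℝ) < t j.succ := by
      by_contra! hc
      have : ∀ j : Fin (n + 1), t j ≤ x := by
        intro j
        induction j using Fin.induction with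
        | zero => rw [ht0]; exact x.2.1
        | succ j ih => exact hc j ih
      have := this (Fin.last n)
      rw [ht1] at this
      exact absurd hx (not_lt.2 this)
    obtain ⟨c, hc, h⟩ := hslope j
    refine ⟨c, hc, ?_⟩
    have : x < (⟨_, hrange j.succ⟩ : UI) := hj2
    filter_upwards [self_mem_nhdsWithin, mem_nhdsWithin_of_mem_nhds (Iio_mem_nhds this)] with s h1 h2
    exact h s x (hj1.trans h1) (le_of_lt h2) hj1 hj2.le
  · rcases eq_or_lt_of_le (unitInterval.nonneg' (t := x)) with rfl | hx
    · refine ⟨1, one_pos, ?_⟩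
      filter_upwards [self_mem_nhdsWithin] with s hs
      have : s = 0 := le_antisymm hs unitInterval.nonneg'
      simp [this]
    obtain ⟨j, hj1, hj2⟩ : ∃ j : Fin n, t j.castSucc < x ∧ (x : ℝ) ≤ t j.succ := by
      by_contra! hc
      have : ∀ j : Fin (n + 1), t j < x := by
        intro j
        induction j using Fin.induction with
        | zero => rw [ht0]; exact hx
        | succ j ih => exact hc j ih
      have := this (Fin.last n)
      rw [ht1] at this
      exact absurd x.2.2 (not_le.2 this)
    obtain ⟨c, hc, h⟩ := hslope j
    refine ⟨c, hc, ?_⟩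
    have : (⟨_, hrange j.castSucc⟩ : UI) < x := hj1
    filter_upwards [self_mem_nhdsWithin, mem_nhdsWithin_of_mem_nhds (Ioi_mem_nhds this)] with s h1 h2
    exact h s x (le_of_lt h2) (le_trans h1 hj2) hj1.le hj2

/-! ### Reversing the interval -/

/-- The orientation-reversing involution of the unit interval. -/
def reflection : Homeo01 := Function.Involutive.toPerm unitInterval.symm unitInterval.symm_involutive

lemma coe_reflection (x : UI) : (reflection x : ℝ) = 1 - x := rfl

@[simp] lemma reflection_reflection (x : UI) : reflection (reflection x) = x :=
  unitInterval.symm_symm x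

@[simp] lemma reflection_le {x y : UI} : reflection x ≤ reflection y ↔ y ≤ x :=
  unitInterval.symm_le_symm

@[simp] lemma reflection_lt {x y : UI} : reflection x < reflection y ↔ y < x :=
  unitInterval.symm_lt_symm

/-- Conjugation by the reflection of the interval. -/
def flip : Homeo01 ≃* Homeo01 := MulAut.conj reflection

lemma flip_apply (g : Homeo01) (x : UI) : flip g x = reflection (g (reflection x)) := rfl

@[simp] lemma flip_flip (g : Homeo01) : flip (flip g) = g := by
  ext1 x
  simp [flip_apply]

@[simp] lemma flip_apply_reflection (g : Homeo01) (x : UI) : flip g (reflection x) = reflection (g x) := by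
  simp [flip_apply]

lemma tendsto_reflection_le (x : UI) : Tendsto reflection (𝓝[≤] x) (𝓝[≥] (reflection x)) :=
  unitInterval.continuous_symm.continuousWithinAt.tendsto_nhdsWithin fun _ hy =>
    reflection_le.2 hy

lemma tendsto_reflection_ge (x : UI) : Tendsto reflection (𝓝[≥] x) (𝓝[≤] (reflection x)) :=
  unitInterval.continuous_symm.continuousWithinAt.tendsto_nhdsWithin fun _ hy =>
    reflection_le.2 hy

lemma HasRightSlope.flip {g : Homeo01} {x : UI} {c : ℝ} (h : HasRightSlope g x c) :
    HasLeftSlope (flip g) (reflection x) c := by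
  have := tendsto_reflection_le (reflection x)
  rw [reflection_reflection] at this
  filter_upwards [this.eventually h] with s hs
  rw [flip_apply, flip_apply, coe_reflection, hs]
  simp [coe_reflection]
  ring

lemma HasLeftSlope.flip {g : Homeo01} {x : UI} {c : ℝ} (h : HasLeftSlope g x c) :
    HasRightSlope (flip g) (reflection x) c := by
  have := tendsto_reflection_ge (reflection x)
  rw [reflection_reflection] at this
  filter_upwards [this.eventually h] with s hs
  rw [flip_apply, flip_apply, coe_reflection, hs]
  simp [coe_reflection]
  ring

lemma flip_mem_PLG {g : Homeo01} (hg : g ∈ PLG) : flip g ∈ PLG := by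
  obtain ⟨hm, hs⟩ := hg
  refine ⟨fun x y h => ?_, fun x => ?_⟩
  · rw [flip_apply, flip_apply, reflection_le]
    exact hm (reflection_le.2 h)
  · obtain ⟨⟨c, hc, h1⟩, d, hd, h2⟩ := hs (reflection x)
    have e1 := h1.flip
    have e2 := h2.flip
    rw [reflection_reflection] at e1 e2
    exact ⟨⟨d, hd, e2⟩, c, hc, e1⟩

lemma ContainsF.of_map {G : Subgroup Homeo01} (φ : Homeo01 ≃* Homeo01)
    (h : ContainsF (G.map φ.toMonoidHom)) : ContainsF G := by
  obtain ⟨ψ, h1, h2, h3⟩ := h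
  refine ⟨fun g => φ.symm (ψ g), fun g hg h hh e => h1 hg hh (φ.symm.injective e), fun g hg => ?_,
    fun g h hg hh => by simp [h3 g h hg hh]⟩
  obtain ⟨x, hx, e⟩ := h2 g hg
  simp only [← e]
  simpa using hx

/-! ### Orbits -/

lemma IsOPH.mul {g h : Homeo01} (hg : IsOPH g) (hh : IsOPH h) : IsOPH (g * h) :=
  Monotone.comp (g := g) (f := h) hg hh

/-- Points without global fixed points between them can be moved arbitrarily far to the left. -/
lemma exists_apply_lt {H : Subgroup Homeo01} (hH : ∀ h ∈ H, IsOPH h) {p b : UI}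
    (hmove : ∀ t, p < t → t < b → ∃ h ∈ H, h t ≠ t) {x y : UI} (hx : x < b) (hy : p < y) :
    ∃ h ∈ H, h x < y := by
  by_contra! hc
  set m : UI := sInf {t | ∃ h ∈ H, h x = t} with hm
  have hle : ∀ h ∈ H, m ≤ h x := fun h hh => sInf_le ⟨h, hh, rfl⟩
  have h1 : p < m := hy.trans_le <| le_sInf <| by
    rintro _ ⟨h, hh, rfl⟩
    exact hc h hh
  have h2 : m < b := (hle 1 (one_mem _)).trans_lt hx
  have key : ∀ h ∈ H, ¬ h m < m := by
    intro h hh hlt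
    have : m < h⁻¹ m := by
      rw [← (hH h hh).strictMono.lt_iff_lt, apply_inv_apply]
      exact hlt
    obtain ⟨_, ⟨k, hk, rfl⟩, hkm⟩ := sInf_lt_iff.1 this
    have e1 : h (k x) < m := by
      have := (hH h hh).strictMono hkm
      rwa [apply_inv_apply] at this
    exact absurd (hle (h * k) (mul_mem hh hk)) (not_le.2 e1)
  obtain ⟨h, hh, hne⟩ := hmove m h1 h2
  rcases lt_or_gt_of_ne hne with h3 | h3
  · exact key h hh h3
  · refine key h⁻¹ (inv_mem hh) ?_
    rwa [← (hH h hh).strictMono.lt_iff_lt, apply_inv_apply]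

lemma exists_lt_apply {H : Subgroup Homeo01} (hH : ∀ h ∈ H, IsOPH h) {p b : UI}
    (hmove : ∀ t, p < t → t < b → ∃ h ∈ H, h t ≠ t) {x y : UI} (hx : p < x) (hy : y < b) :
    ∃ h ∈ H, y < h x := by
  obtain ⟨h, hh, hlt⟩ := exists_apply_lt hH hmove hy hx
  refine ⟨h⁻¹, inv_mem hh, ?_⟩
  rwa [← (hH h hh).strictMono.lt_iff_lt, apply_inv_apply]

/-! ### Linear germs at fixed points -/

/-- `g` is the homothety with centre `p` and ratio `l` on `[p, z]`. -/
def LinOn (g : Homeo01) (p z : UI) (l : ℝ) : Prop :=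
  ∀ s, p ≤ s → s ≤ z → (g s : ℝ) = p + l * (s - p)

lemma LinOn.mono {g : Homeo01} {p z z' : UI} {l : ℝ} (h : LinOn g p z l) (hz : z' ≤ z) :
    LinOn g p z' l := fun s h1 h2 => h s h1 (h2.trans hz)

lemma HasRightSlope.exists_linOn {g : Homeo01} {p b : UI} {l : ℝ} (h : HasRightSlope g p l)
    (hp : g p = p) (hb : p < b) : ∃ z, p < z ∧ z < b ∧ LinOn g p z l := by
  obtain ⟨z, h1, h2, h3⟩ := (eventually_nhdsGE_iff hb).1 h
  exact ⟨z, h1, h2, fun s h4 h5 => by rw [h3 s h4 h5, hp]⟩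

lemma LinOn.le_apply {g : Homeo01} {p z : UI} {l : ℝ} (h : LinOn g p z l) (hl : 0 < l)
    {s : UI} (h1 : p ≤ s) (h2 : s ≤ z) : p ≤ g s := by
  rw [← Subtype.coe_le_coe, h s h1 h2]
  have : (0 : ℝ) ≤ s - p := sub_nonneg.2 h1
  nlinarith

lemma LinOn.apply_le {g : Homeo01} {p z : UI} {l : ℝ} (h : LinOn g p z l) (hl : l ≤ 1)
    {s : UI} (h1 : p ≤ s) (h2 : s ≤ z) : g s ≤ s := by
  rw [← Subtype.coe_le_coe, h s h1 h2]
  have : (0 : ℝ) ≤ s - p := sub_nonneg.2 h1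
  nlinarith

lemma LinOn.pow {g : Homeo01} {p z : UI} {l : ℝ} (h : LinOn g p z l) (hl : 0 < l) (hl1 : l ≤ 1)
    (m : ℕ) : LinOn (g ^ m) p z (l ^ m) := by
  induction m with
  | zero => intro s _ _; simp
  | succ m ih =>
    intro s h1 h2
    rw [pow_succ, Equiv.Perm.mul_apply,
      ih _ (h.le_apply hl h1 h2) ((h.apply_le hl1 h1 h2).trans h2), h s h1 h2]
    ring

lemma LinOn.eventually_pow_lt {g : Homeo01} {p z d : UI} {l : ℝ} (h : LinOn g p z l) (hl : 0 < l)
    (hl1 : l < 1) (hz : p ≤ z) (hd : p < d) : ∀ᶠ m in atTop, (g ^ m) z < d := by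
  have h1 : Tendsto (fun m : ℕ => (p : ℝ) + l ^ m * (z - p)) atTop (𝓝 (p + 0 * (z - p))) :=
    ((tendsto_pow_atTop_nhds_zero_of_lt_one hl.le hl1).mul_const _).const_add _
  rw [zero_mul, add_zero] at h1
  filter_upwards [h1.eventually_lt_const (show (p : ℝ) < d from hd)] with m hm
  rw [← Subtype.coe_lt_coe, h.pow hl hl1.le m z hz le_rfl]
  exact hm

lemma pow_apply_of_fixed {g : Homeo01} {t : UI} (h : g t = t) (m : ℕ) : (g ^ m) t = t := by
  induction m with
  | zero => rfl
  | succ m ih => rw [pow_succ, Equiv.Perm.mul_apply, h, ih]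

lemma inv_apply_of_fixed {g : Homeo01} {t : UI} (h : g t = t) : g⁻¹ t = t := by
  conv_lhs => rw [← h]
  exact inv_apply_apply g t

lemma mem_PLG_slope {g : Homeo01} (hg : g ∈ PLG) (p : UI) : ∃ c > 0, HasRightSlope g p c :=
  (hg.2 p).1

lemma hasRightSlope_conj {g h : Homeo01} (hg : IsOPH g) (hh : h ∈ PLG) {p : UI}
    {c : ℝ} (hs : HasRightSlope g p c) (hgp : g p = p) : HasRightSlope (h * g * h⁻¹) (h p) c := by
  obtain ⟨d, hd, h1⟩ := mem_PLG_slope hh p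
  have h2 := h1.inv hh.1 hd
  have h3 : HasRightSlope g (h⁻¹ (h p)) c := by rwa [inv_apply_apply]
  have h4 : HasRightSlope h ((g * h⁻¹) (h p)) d := by
    rwa [Equiv.Perm.mul_apply, inv_apply_apply, hgp]
  have h5 := h4.mul (hg.mul hh.1.inv) (h3.mul hh.1.inv h2)
  rw [mul_assoc]
  have e : d * (c * d⁻¹) = c := by field_simp
  rwa [e] at h5

/-- Brin's ubiquity argument, with a contracting germ at the left end of the orbital. -/
lemma containsF_of_contraction {H : Subgroup Homeo01} (hH : H ≤ PLG) {p b q : UI}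
    (hmove : ∀ t, p < t → t < b → ∃ h ∈ H, h t ≠ t)
    (hfix : ∀ h ∈ H, ∀ t, ¬ (p < t ∧ t < b) → h t = t)
    {c : Homeo01} (hc : c ∈ H) (hpq : p < q) (hqb : q < b) (hcq : ∀ t, q ≤ t → c t = t)
    {l : ℝ} (hl : 0 < l) (hl1 : l < 1) (hcl : HasRightSlope c p l) : ContainsF H := by
  have hfp : ∀ h ∈ H, h p = p := fun h hh => hfix h hh p (by simp)
  have hm : ∀ h ∈ H, IsOPH h := fun h hh => (hH hh).1
  obtain ⟨r, hpr, hrb, hcr⟩ := hcl.exists_linOn (hfp c hc) (hpq.trans hqb)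
  obtain ⟨h, hh, hhq⟩ := exists_apply_lt hm hmove hqb hpr
  set g := h * c * h⁻¹ with hg
  have hgH : g ∈ H := mul_mem (mul_mem hh hc) (inv_mem hh)
  have hgs : HasRightSlope g p l := by
    have := hasRightSlope_conj (hm c hc) (hH hh) hcl (hfp c hc)
    rwa [hfp h hh] at this
  have hgq : ∀ t, h q ≤ t → g t = t := by
    intro t ht
    have : q ≤ h⁻¹ t := by
      rwa [← (hm h hh).strictMono.le_iff_le, apply_inv_apply]
    rw [hg, Equiv.Perm.mul_apply, Equiv.Perm.mul_apply, hcq _ this, apply_inv_apply]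
  obtain ⟨d, hpd, hdr, hgd⟩ := hgs.exists_linOn (hfp g hgH) hpr
  obtain ⟨m, hmd⟩ := eventually_atTop.1 (hcr.eventually_pow_lt hl hl1 hpr.le hpd)
  obtain ⟨n, hn, hn1⟩ : ∃ n, m ≤ n ∧ 1 ≤ n := ⟨max m 1, le_max_left _ _, le_max_right _ _⟩
  set C := c ^ n with hC
  set D := g ^ n with hD
  have hCH : C ∈ H := pow_mem hc n
  have hDH : D ∈ H := pow_mem hgH n
  have hCD : ∀ s, s ≤ d → D s = C s := by
    intro s hs
    rcases le_total p s with h1 | h1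
    · apply Subtype.ext
      rw [hC, hD, (hcr.mono hdr.le).pow hl hl1.le n s h1 hs, hgd.pow hl hl1.le n s h1 hs]
    · rw [hfix D hDH s (fun h => absurd h.1 (not_lt.2 h1)),
        hfix C hCH s (fun h => absurd h.1 (not_lt.2 h1))]
  have hfar : ∀ (k : ℕ) (s : UI), d ≤ s → (C ^ (k + 1) * D⁻¹ * (C ^ (k + 1))⁻¹) s = s := by
    intro k s hs
    have : h q ≤ (C ^ (k + 1))⁻¹ s := by
      by_contra! hlt
      have h1 := (hm _ (pow_mem hCH (k + 1))).strictMono (hlt.trans hhq)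
      rw [apply_inv_apply, hC, ← pow_mul] at h1
      exact absurd (hmd (n * (k + 1)) (by nlinarith)) (not_lt.2 (hs.trans h1.le))
    rw [Equiv.Perm.mul_apply, Equiv.Perm.mul_apply,
      inv_apply_of_fixed (pow_apply_of_fixed (hgq _ this) n), apply_inv_apply]
  have hT : ThompsonSeq (seqOfPair C⁻¹ D⁻¹) := by
    refine ThompsonSeq.of_commute fun k => Equiv.Perm.Disjoint.commute fun s => ?_
    rcases le_total s d with hs | hs
    · left
      rw [inv_inv, Equiv.Perm.mul_apply, hCD s hs, inv_apply_apply]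
    · right
      have := hfar k s hs
      rwa [inv_pow, inv_inv]
  refine hT.containsF ?_ ?_
  · intro e
    have e2 : D⁻¹ = C ^ (0 + 1) * D⁻¹ * (C ^ (0 + 1))⁻¹ := by
      simpa [seqOfPair] using e
    have e3 : D⁻¹ d = d := by
      rw [e2]; exact hfar 0 d le_rfl
    have e4 : D d = d := by
      conv_lhs => rw [← e3]
      exact apply_inv_apply D d
    have e5 := hgd.pow hl hl1.le n d hpd.le le_rfl
    rw [← hD, e4] at e5
    have e6 : l ^ n < 1 := pow_lt_one₀ hl.le hl1 (by omega)
    have e7 : (p : ℝ) < d := hpd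
    nlinarith
  · intro i
    cases i with
    | zero => exact inv_mem hCH
    | succ k => exact H.mul_mem (H.mul_mem (H.inv_mem (H.pow_mem (H.inv_mem hCH) k))
        (H.inv_mem hDH)) (H.pow_mem (H.inv_mem hCH) k)

/-- Brin's ubiquity theorem for elements realizing only the left end of the orbital. -/
lemma containsF_of_left {H : Subgroup Homeo01} (hH : H ≤ PLG) {p b q : UI}
    (hmove : ∀ t, p < t → t < b → ∃ h ∈ H, h t ≠ t)
    (hfix : ∀ h ∈ H, ∀ t, ¬ (p < t ∧ t < b) → h t = t)
    {c : Homeo01} (hc : c ∈ H) (hpq : p < q) (hqb : q < b) (hcq : ∀ t, q ≤ t → c t = t)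
    (hc1 : ¬ HasRightSlope c p 1) : ContainsF H := by
  obtain ⟨l, hl, hcl⟩ := mem_PLG_slope (hH hc) p
  have hcp : c p = p := hfix c hc p (by simp)
  rcases lt_trichotomy l 1 with h | rfl | h
  · exact containsF_of_contraction hH hmove hfix hc hpq hqb hcq hl h hcl
  · exact absurd hcl hc1
  · refine containsF_of_contraction hH hmove hfix (inv_mem hc) hpq hqb
      (fun t ht => inv_apply_of_fixed (hcq t ht)) (inv_pos.2 hl) (inv_lt_one_of_one_lt₀ h) ?_
    have := hcl.inv (hH hc).1 hl
    rwa [hcp] at this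

lemma containsF_of_right {H : Subgroup Homeo01} (hH : H ≤ PLG) {p b q : UI}
    (hmove : ∀ t, p < t → t < b → ∃ h ∈ H, h t ≠ t)
    (hfix : ∀ h ∈ H, ∀ t, ¬ (p < t ∧ t < b) → h t = t)
    {c : Homeo01} (hc : c ∈ H) (hpq : p < q) (hqb : q < b) (hcq : ∀ t, t ≤ q → c t = t)
    (hc1 : ¬ HasLeftSlope c b 1) : ContainsF H := by
  refine ContainsF.of_map flip (containsF_of_left (p := reflection b) (b := reflection p)
    (q := reflection q) (c := flip c) ?_ ?_ ?_ (Subgroup.mem_map_of_mem _ hc) (reflection_lt.2 hqb)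
    (reflection_lt.2 hpq) ?_ ?_)
  · rintro _ ⟨h, hh, rfl⟩
    exact flip_mem_PLG (hH hh)
  · intro t h1 h2
    obtain ⟨h, hh, hne⟩ := hmove (reflection t) (by rwa [← reflection_lt, reflection_reflection])
      (by rwa [← reflection_lt, reflection_reflection])
    refine ⟨flip h, Subgroup.mem_map_of_mem _ hh, fun e => hne ?_⟩
    rw [flip_apply] at e
    rw [← reflection_reflection (h _), e]
  · rintro _ ⟨h, hh, rfl⟩ t ht
    have := hfix h hh (reflection t) fun ⟨h1, h2⟩ => ht
      ⟨by rwa [← reflection_lt, reflection_reflection], by rwa [← reflection_lt, reflection_reflection]⟩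
    change flip h t = t
    rw [flip_apply, this, reflection_reflection]
  · intro t ht
    rw [flip_apply, hcq _ (by rwa [← reflection_le, reflection_reflection]), reflection_reflection]
  · intro h
    have := h.flip
    rw [flip_flip, reflection_reflection] at this
    exact hc1 this

/-! ### One-orbital groups -/

/-- `G` is a group of piecewise linear homeomorphisms with the single orbital `(A, B)`. -/
structure OneOrbital (G : Subgroup Homeo01) (A B : UI) : Prop where
  le_PLG : G ≤ PLG
  lt : A < B
  move : ∀ t, A < t → t < B → ∃ g ∈ G, g t ≠ t
  fix : ∀ g ∈ G, ∀ t, ¬ (A < t ∧ t < B) → g t = t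

namespace OneOrbital
variable {G : Subgroup Homeo01} {A B : UI}

lemma fix_left (h : OneOrbital G A B) {g : Homeo01} (hg : g ∈ G) : g A = A :=
  h.fix g hg A (by simp)

lemma fix_right (h : OneOrbital G A B) {g : Homeo01} (hg : g ∈ G) : g B = B :=
  h.fix g hg B (by simp)

lemma isOPH (h : OneOrbital G A B) {g : Homeo01} (hg : g ∈ G) : IsOPH g := (h.le_PLG hg).1

lemma lt_apply (h : OneOrbital G A B) {g : Homeo01} (hg : g ∈ G) {t : UI} (ht : A < t) :
    A < g t := by
  have := (h.isOPH hg).strictMono ht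
  rwa [h.fix_left hg] at this

lemma apply_lt (h : OneOrbital G A B) {g : Homeo01} (hg : g ∈ G) {t : UI} (ht : t < B) :
    g t < B := by
  have := (h.isOPH hg).strictMono ht
  rwa [h.fix_right hg] at this

lemma flip (h : OneOrbital G A B) :
    OneOrbital (G.map flip.toMonoidHom) (reflection B) (reflection A) where
  le_PLG := by
    rintro _ ⟨g, hg, rfl⟩
    exact flip_mem_PLG (h.le_PLG hg)
  lt := reflection_lt.2 h.lt
  move := by
    intro t h1 h2
    obtain ⟨g, hg, hne⟩ := h.move (reflection t) (by rwa [← reflection_lt, reflection_reflection])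
      (by rwa [← reflection_lt, reflection_reflection])
    refine ⟨_, Subgroup.mem_map_of_mem _ hg, fun e => hne ?_⟩
    change PingPong.flip g t = t at e
    rw [flip_apply] at e
    rw [← reflection_reflection (g _), e]
  fix := by
    rintro _ ⟨g, hg, rfl⟩ t ht
    have := h.fix g hg (reflection t) fun ⟨h1, h2⟩ => ht
      ⟨by rwa [← reflection_lt, reflection_reflection], by rwa [← reflection_lt, reflection_reflection]⟩
    change PingPong.flip g t = t
    rw [flip_apply, this, reflection_reflection]

lemma slope_mul (h : OneOrbital G A B) {g k : Homeo01} (hg : g ∈ G) {c d : ℝ}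
    (h1 : HasRightSlope g A c) (h2 : HasRightSlope k A d) : HasRightSlope (k * g) A (d * c) := by
  have h3 : HasRightSlope k (g A) d := by rwa [h.fix_left hg]
  exact h3.mul (h.isOPH hg) h1

lemma slope_inv (h : OneOrbital G A B) {g : Homeo01} (hg : g ∈ G) {c : ℝ} (hc : 0 < c)
    (h1 : HasRightSlope g A c) : HasRightSlope g⁻¹ A c⁻¹ := by
  have := h1.inv (h.isOPH hg) hc
  rwa [h.fix_left hg] at this

lemma hasLeftSlope_one (h : OneOrbital G A B) (hF : ¬ ContainsF G) {g : Homeo01} (hg : g ∈ G)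
    (h1 : HasRightSlope g A 1) : HasLeftSlope g B 1 := by
  by_contra hc
  obtain ⟨q, h2, h3, h4⟩ := h1.exists_linOn (h.fix_left hg) h.lt
  refine hF (containsF_of_right h.le_PLG h.move h.fix hg h2 h3 (fun t ht => ?_) hc)
  rcases le_total A t with h5 | h5
  · apply Subtype.ext
    rw [h4 t h5 ht]; ring
  · exact h.fix g hg t fun h => absurd h.1 (not_lt.2 h5)

lemma hasRightSlope_one (h : OneOrbital G A B) (hF : ¬ ContainsF G) {g : Homeo01} (hg : g ∈ G)
    (h1 : HasLeftSlope g B 1) : HasRightSlope g A 1 := by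
  have := h.flip.hasLeftSlope_one (fun hc => hF (hc.of_map _)) (Subgroup.mem_map_of_mem _ hg)
    h1.flip
  have := this.flip
  rw [reflection_reflection] at this
  change HasRightSlope (PingPong.flip (PingPong.flip g)) A 1 at this
  rwa [flip_flip] at this

lemma exists_apply_lt (h : OneOrbital G A B) {x y : UI} (hx : x < B) (hy : A < y) :
    ∃ g ∈ G, g x < y := PingPong.exists_apply_lt (fun _ hg => h.isOPH hg) h.move hx hy

lemma exists_lt_apply (h : OneOrbital G A B) {x y : UI} (hx : A < x) (hy : y < B) :
    ∃ g ∈ G, y < g x := PingPong.exists_lt_apply (fun _ hg => h.isOPH hg) h.move hx hy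

end OneOrbital

/-! ### Dense slopes -/

/-- The slopes at `A` of the elements of `G` are dense in the positive reals. -/
def DenseSlopes (G : Subgroup Homeo01) (A : UI) : Prop :=
  ∀ u v : ℝ, 0 < u → u < v → ∃ g ∈ G, ∃ l, u < l ∧ l < v ∧ HasRightSlope g A l

lemma OneOrbital.exists_between {G : Subgroup Homeo01} {A B : UI} (h : OneOrbital G A B)
    (hd : DenseSlopes G A) {p r p' t : UI} (hp : A < p) (hpr : p < r) (hr : r < B)
    (hp' : A < p') (hpt : p' < t) (ht : t < B) : ∃ g ∈ G, p' < g p ∧ g p < t ∧ t < g r := by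
  obtain ⟨f, hf, l, hl0, hl1, hfl⟩ := hd (1 / 2) 1 (by norm_num) (by norm_num)
  have hl : 0 < l := by linarith
  obtain ⟨z, hz, hzB, hfz⟩ := hfl.exists_linOn (h.fix_left hf) h.lt
  obtain ⟨k₀, hk₀, hk₀z⟩ := h.exists_apply_lt hr hz
  obtain ⟨k, hk, hkz⟩ := h.exists_apply_lt ht hz
  have P0 : (A : ℝ) < k₀ p := h.lt_apply hk₀ hp
  have PR : (k₀ p : ℝ) < k₀ r := (h.isOPH hk₀).strictMono hpr
  have P0' : (A : ℝ) < k p' := h.lt_apply hk hp'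
  have PT : (k p' : ℝ) < k t := (h.isOPH hk).strictMono hpt
  have hlt : max (((k p' : ℝ) - A) / (k₀ p - A)) ((k t - A) / (k₀ r - A)) < (k t - A) / (k₀ p - A) := by
    apply max_lt
    · have : (0 : ℝ) < k₀ p - A := by linarith
      gcongr
    · have : (0 : ℝ) < k₀ p - A := by linarith
      have : (0 : ℝ) < k t - A := by linarith
      gcongr
  obtain ⟨w, hw, s, hs1, hs2, hws⟩ := hd _ _
    (lt_max_of_lt_left (div_pos (sub_pos.2 P0') (sub_pos.2 P0))) hlt
  have hs3 := (le_max_left _ _).trans_lt hs1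
  have hs4 := (le_max_right _ _).trans_lt hs1
  rw [div_lt_iff₀ (by linarith)] at hs3 hs4
  rw [lt_div_iff₀ (by linarith)] at hs2
  obtain ⟨y, hy, hyB, hwy⟩ := hws.exists_linOn (h.fix_left hw) h.lt
  obtain ⟨m, hm⟩ := (hfz.eventually_pow_lt hl hl1 hz.le hy).exists
  have hfm := hfz.pow hl hl1.le m
  have hfmG : f ^ m ∈ G := pow_mem hf m
  have hlm : 0 < l ^ m := by positivity
  have hwf : ∀ x : UI, A ≤ x → x ≤ z → (w ((f ^ m) x) : ℝ) = A + s * (l ^ m * (x - A)) := by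
    intro x h1 h2
    rw [hwy _ (hfm.le_apply hlm h1 h2) ((((h.isOPH hfmG) h2).trans_lt hm).le), hfm x h1 h2]
    ring
  have hkz' : k p' ≤ z := (le_of_lt PT).trans hkz.le
  have hkz₀' : k₀ p ≤ z := (le_of_lt PR).trans hk₀z.le
  have e1 := hwf (k₀ p) P0.le hkz₀'
  have e2 := hwf (k₀ r) (P0.trans PR).le hk₀z.le
  have e3 := hfm (k t) (P0'.trans PT).le hkz.le
  have e4 := hfm (k p') P0'.le hkz'
  have hgG : (f ^ m * k)⁻¹ * (w * f ^ m * k₀) ∈ G :=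
    G.mul_mem (G.inv_mem (G.mul_mem hfmG hk)) (G.mul_mem (G.mul_mem hw hfmG) hk₀)
  have hfk := (h.isOPH (G.mul_mem hfmG hk)).strictMono
  refine ⟨_, hgG, ?_, ?_, ?_⟩
  · rw [← hfk.lt_iff_lt, Equiv.Perm.mul_apply _ (w * _ * _), apply_inv_apply]
    change (((f ^ m) (k p') : UI) : ℝ) < w ((f ^ m) (k₀ p))
    rw [e1, e4]
    nlinarith
  · rw [← hfk.lt_iff_lt, Equiv.Perm.mul_apply _ (w * _ * _), apply_inv_apply]
    change (w ((f ^ m) (k₀ p)) : ℝ) < ((f ^ m) (k t) : UI)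
    rw [e1, e3]
    nlinarith
  · rw [← hfk.lt_iff_lt, Equiv.Perm.mul_apply _ (w * _ * _), apply_inv_apply]
    change (((f ^ m) (k t) : UI) : ℝ) < w ((f ^ m) (k₀ r))
    rw [e2, e3]
    nlinarith

/-- The leftmost fixed stretch of an element with trivial germ at `A`. -/
lemma OneOrbital.exists_first {G : Subgroup Homeo01} {A B : UI} (h : OneOrbital G A B)
    {c : Homeo01} (hc : c ∈ G) (hc1 : c ≠ 1) (hcA : HasRightSlope c A 1) :
    ∃ p r, A < p ∧ p < r ∧ r < B ∧ (∀ t ≤ p, c t = t) ∧ (∀ t, p < t → t ≤ r → c t ≠ t) ∧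
      ¬ HasRightSlope c p 1 := by
  have hcm := h.isOPH hc
  set p : UI := sInf (supt c) with hp
  have hne : ∃ t, t ∈ supt c := by
    by_contra! hcon
    exact hc1 (Equiv.ext fun t => by simpa [supt] using hcon t)
  obtain ⟨t₀, ht₀⟩ := hne
  have hsupp : ∀ t ∈ supt c, A < t ∧ t < B := fun t ht => by
    by_contra hcon
    exact ht (h.fix c hc t hcon)
  have hpB : p < B := (sInf_le ht₀).trans_lt (hsupp _ ht₀).2
  have hlt : ∀ t < p, c t = t := fun t ht => by
    by_contra hcon
    exact absurd (sInf_le (show t ∈ supt c from hcon)) (not_le.2 ht)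
  have hAp : A < p := by
    obtain ⟨z, hz, -, hcz⟩ := hcA.exists_linOn (h.fix_left hc) h.lt
    refine hz.trans_le (le_sInf fun t ht => ?_)
    by_contra! hcon
    exact ht (Subtype.ext (by rw [hcz t (hsupp t ht).1.le hcon.le]; ring))
  have hcp : c p = p := by
    rcases lt_trichotomy (c p) p with h1 | h1 | h1
    · have := hlt _ h1
      exact absurd (c.injective this) h1.ne
    · exact h1
    · obtain ⟨s, h2, h3⟩ := _root_.exists_between h1
      have h4 : c⁻¹ s < p := by
        rwa [← hcm.strictMono.lt_iff_lt, apply_inv_apply]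
      have h5 := hlt _ h4
      rw [apply_inv_apply] at h5
      rw [← h5] at h4
      exact absurd h4 (not_lt.2 h2.le)
  have hle : ∀ t ≤ p, c t = t := fun t ht => by
    rcases ht.lt_or_eq with h1 | rfl
    · exact hlt t h1
    · exact hcp
  obtain ⟨l, hl, hcl⟩ := mem_PLG_slope (h.le_PLG hc) p
  obtain ⟨r, hpr, hrB, hlin⟩ := hcl.exists_linOn hcp hpB
  have hl1 : l ≠ 1 := by
    rintro rfl
    have : r ≤ p := le_sInf fun t ht => by
      by_contra! hcon
      rcases le_total p t with h1 | h1
      · exact ht (Subtype.ext (by rw [hlin t h1 hcon.le]; ring))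
      · exact ht (hle t h1)
    exact absurd hpr (not_lt.2 this)
  refine ⟨p, r, hAp, hpr, hrB, hle, fun t h1 h2 h3 => hl1 ?_, fun h1 => hl1 ?_⟩
  · have := hlin t h1.le h2
    rw [h3] at this
    have h4 : (p : ℝ) < t := h1
    have h5 : (t - p : ℝ) ≠ 0 := by linarith
    apply mul_right_cancel₀ h5
    linarith
  · exact hcl.unique (hpB.trans_le unitInterval.le_one') h1

lemma HasLeftSlope.exists_forall_ge {g : Homeo01} {b a : UI} (h : HasLeftSlope g b 1) (hb : g b = b)
    (ha : a < b) : ∃ q, a < q ∧ q < b ∧ ∀ t, q ≤ t → t ≤ b → g t = t := by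
  have hb' : PingPong.flip g (reflection b) = reflection b := by
    rw [flip_apply_reflection, hb]
  obtain ⟨z, h1, h2, h3⟩ := h.flip.exists_linOn hb' (reflection_lt.2 ha)
  refine ⟨reflection z, by rwa [← reflection_lt, reflection_reflection],
    by rwa [← reflection_lt, reflection_reflection], fun t h4 h5 => ?_⟩
  have h6 : PingPong.flip g (reflection t) = reflection t := by
    apply Subtype.ext
    rw [h3 _ (reflection_le.2 h5) (by rwa [← reflection_le, reflection_reflection])]
    ring
  rw [flip_apply_reflection] at h6
  exact reflection.injective h6

lemma OneOrbital.containsF_of_dense_of_ne {G : Subgroup Homeo01} {A B : UI}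
    (h : OneOrbital G A B) (hd : DenseSlopes G A) {c : Homeo01} (hc : c ∈ G) (hc1 : c ≠ 1)
    (hcA : HasRightSlope c A 1) : ContainsF G := by
  by_contra hF
  have hcB := h.hasLeftSlope_one hF hc hcA
  obtain ⟨p, r, hAp, hpr, hrB, hle, hmv, hcp⟩ := h.exists_first hc hc1 hcA
  obtain ⟨q, hrq, hqB, hq⟩ := hcB.exists_forall_ge (h.fix_right hc) hrB
  have hq' : ∀ t, q ≤ t → c t = t := fun t ht => by
    rcases le_total t B with h1 | h1
    · exact hq t ht h1
    · exact h.fix c hc t fun h2 => absurd h2.2 (not_lt.2 h1)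
  let H : Subgroup Homeo01 :=
    { carrier := {x | x ∈ G ∧ (∀ t ≤ p, x t = t) ∧ ∃ q < B, ∀ t, q ≤ t → x t = t}
      mul_mem' := by
        rintro x y ⟨hx, hx1, q, hq, hx2⟩ ⟨hy, hy1, q', hq', hy2⟩
        refine ⟨G.mul_mem hx hy, fun t ht => ?_, max q q', max_lt hq hq', fun t ht => ?_⟩
        · rw [Equiv.Perm.mul_apply, hy1 t ht, hx1 t ht]
        · rw [Equiv.Perm.mul_apply, hy2 t ((le_max_right _ _).trans ht),
            hx2 t ((le_max_left _ _).trans ht)]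
      one_mem' := ⟨G.one_mem, fun _ _ => rfl, A, h.lt, fun _ _ => rfl⟩
      inv_mem' := by
        rintro x ⟨hx, hx1, q, hq, hx2⟩
        exact ⟨G.inv_mem hx, fun t ht => inv_apply_of_fixed (hx1 t ht), q, hq,
          fun t ht => inv_apply_of_fixed (hx2 t ht)⟩ }
  have hHG : H ≤ G := fun x hx => hx.1
  refine hF (ContainsF.mono (containsF_of_left (H := H) (p := p) (b := B) (q := q) (c := c)
    (hHG.trans h.le_PLG) ?_ ?_ ⟨hc, hle, q, hqB, hq'⟩ (hpr.trans hrq) hqB hq' hcp) hHG)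
  · intro t hpt htB
    obtain ⟨g, hg, h1, h2, h3⟩ := h.exists_between hd hAp hpr hrB hAp hpt htB
    have hgm := h.isOPH hg
    refine ⟨g * c * g⁻¹, ⟨G.mul_mem (G.mul_mem hg hc) (G.inv_mem hg), fun s hs => ?_, g q,
      h.apply_lt hg hqB, fun s hs => ?_⟩, fun e => ?_⟩
    · have : g⁻¹ s ≤ p := by
        rw [← hgm.strictMono.le_iff_le, apply_inv_apply]
        exact hs.trans h1.le
      rw [Equiv.Perm.mul_apply, Equiv.Perm.mul_apply, hle _ this, apply_inv_apply]
    · have : q ≤ g⁻¹ s := by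
        rwa [← hgm.strictMono.le_iff_le, apply_inv_apply]
      rw [Equiv.Perm.mul_apply, Equiv.Perm.mul_apply, hq' _ this, apply_inv_apply]
    · refine hmv (g⁻¹ t) ?_ ?_ ?_
      · rwa [← hgm.strictMono.lt_iff_lt, apply_inv_apply]
      · rw [← hgm.strictMono.le_iff_le, apply_inv_apply]
        exact h3.le
      · apply g.injective
        rw [apply_inv_apply]
        exact e
  · rintro x ⟨hx, hx1, q', hq', hx2⟩ t ht
    rcases le_or_gt t p with h1 | h1
    · exact hx1 t h1
    · exact hx2 t (hq'.le.trans (not_lt.1 fun h2 => ht ⟨h1, h2⟩))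

/-- An element commuting with a linear contraction is linear where the contraction is. -/
lemma exists_forall_apply_pow {f w : Homeo01} {p z b : UI} {l s : ℝ} (hpz : p < z)
    (hl : 0 < l) (hl1 : l < 1) (hfz : LinOn f p z l) (hwf : Commute w f)
    (hw : HasRightSlope w p s) (hwp : w p = p) (hb : p < b) :
    ∃ m : ℕ, ∀ x, p ≤ x → x ≤ z → ((f ^ m) (w x) : ℝ) = p + l ^ m * (s * (x - p)) := by
  obtain ⟨y, hy, hyB, hwy⟩ := hw.exists_linOn hwp hb
  obtain ⟨m, hm⟩ := (hfz.eventually_pow_lt hl hl1 hpz.le hy).exists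
  have hfm := hfz.pow hl hl1.le m
  refine ⟨m, fun x h1 h2 => ?_⟩
  rw [← Equiv.Perm.mul_apply, ← (hwf.pow_right m).eq, Equiv.Perm.mul_apply,
    hwy _ (hfm.le_apply (by positivity) h1 h2), hfm x h1 h2]
  · ring
  · refine le_trans ?_ hm.le
    rw [← Subtype.coe_le_coe, hfm x h1 h2, hfm z hpz.le le_rfl]
    have : (x : ℝ) ≤ z := h2
    gcongr

lemma apply_eq_of_commute {f w : Homeo01} {p z : UI} {l s : ℝ} (hpz : p < z)
    (hl : 0 < l) (hl1 : l < 1) (hfz : LinOn f p z l) (hwf : Commute w f)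
    (hw : HasRightSlope w p s) (hwp : w p = p) {x : UI} (h1 : p ≤ x) (h2 : x ≤ z) (hs : 0 ≤ s)
    (h3 : s * (x - p) ≤ z - p) : (w x : ℝ) = p + s * (x - p) := by
  obtain ⟨m, hm⟩ := exists_forall_apply_pow hpz hl hl1 hfz hwf hw hwp hpz
  have hx : (0 : ℝ) ≤ x - p := sub_nonneg.2 h1
  let y : UI := ⟨p + s * (x - p), by have := p.2.1; positivity, by linarith [z.2.2]⟩
  have hy : (y : ℝ) = p + s * (x - p) := rfl
  have e := hfz.pow hl hl1.le m y (by rw [← Subtype.coe_le_coe, hy]; nlinarith)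
    (by rw [← Subtype.coe_le_coe, hy]; linarith)
  have : w x = y := by
    apply (f ^ m).injective
    apply Subtype.ext
    rw [e, hm x h1 h2, hy]
    ring
  rw [this, hy]

lemma apply_eq_of_commute' {f w : Homeo01} {p z : UI} {l s : ℝ} (hpz : p < z)
    (hl : 0 < l) (hl1 : l < 1) (hfz : LinOn f p z l) (hwf : Commute w f)
    (hw : HasRightSlope w p s) (hwp : w p = p) {x : UI} (h1 : p ≤ x) (h2 : x ≤ z)
    (h3 : p ≤ w x) (h4 : w x ≤ z) : (w x : ℝ) = p + s * (x - p) := by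
  obtain ⟨m, hm⟩ := exists_forall_apply_pow hpz hl hl1 hfz hwf hw hwp hpz
  have e1 := hm x h1 h2
  rw [hfz.pow hl hl1.le m _ h3 h4] at e1
  have hlm : l ^ m ≠ 0 := by positivity
  have := mul_left_cancel₀ hlm (add_left_cancel e1)
  linarith

lemma OneOrbital.containsF_of_dense_of_commute {G : Subgroup Homeo01} {A B : UI}
    (h : OneOrbital G A B) (hd : DenseSlopes G A) (hcomm : ∀ g ∈ G, ∀ k ∈ G, Commute g k) :
    ContainsF G := by
  by_contra hF
  obtain ⟨f, hf, l, hl0, hl1, hfl⟩ := hd (1 / 2) 1 (by norm_num) (by norm_num)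
  have hl : 0 < l := by linarith
  obtain ⟨z, hz, hzB, hfz⟩ := hfl.exists_linOn (h.fix_left hf) h.lt
  have hA1 : A < 1 := h.lt.trans_le unitInterval.le_one'
  obtain ⟨e, he, n, hn, hn1, hen⟩ : ∃ e ∈ G, ∃ n, 0 < n ∧ n < 1 ∧ HasLeftSlope e B n := by
    obtain ⟨n, hn, hfn⟩ := ((h.le_PLG hf).2 B).2
    rcases lt_trichotomy n 1 with h1 | rfl | h1
    · exact ⟨f, hf, n, hn, h1, hfn⟩
    · exact absurd (hfl.unique hA1 (h.hasRightSlope_one hF hf hfn)) hl1.ne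
    · refine ⟨f⁻¹, G.inv_mem hf, n⁻¹, inv_pos.2 hn, inv_lt_one_of_one_lt₀ h1, ?_⟩
      have := hfn.inv (h.isOPH hf) hn
      rwa [h.fix_right hf] at this
  have hfix' : ∀ g ∈ G, PingPong.flip g (reflection B) = reflection B := fun g hg => by
    rw [flip_apply_reflection, h.fix_right hg]
  obtain ⟨y, hy, hyA, hey⟩ := hen.flip.exists_linOn (hfix' e he) (reflection_lt.2 h.lt)
  obtain ⟨u, hAu, huz⟩ := _root_.exists_between hz
  obtain ⟨k, hk, hku⟩ := h.exists_lt_apply (y := reflection y) hAu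
    (by rwa [← reflection_lt, reflection_reflection])
  obtain ⟨κ, hκ, hks⟩ := mem_PLG_slope (h.le_PLG hk) u
  obtain ⟨v, huv, hvz, hkv⟩ := (eventually_nhdsGE_iff huz).1 hks
  have hAu' : (A : ℝ) < u := hAu
  have huv' : (u : ℝ) < v := huv
  have hvz' : (v : ℝ) < z := hvz
  obtain ⟨w, hw, σ, hσ1, hσ2, hwσ⟩ := hd 1 ((v - A) / (u - A)) one_pos
    (by rw [lt_div_iff₀ (by linarith)]; linarith)
  rw [lt_div_iff₀ (by linarith)] at hσ2
  have hσ : 0 < σ := by linarith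
  obtain ⟨ν, hν, hwν⟩ := ((h.le_PLG hw).2 B).2
  have hwm := (h.isOPH hw).strictMono
  have hkm := (h.isOPH hk).strictMono
  have hwA : ∀ x : UI, A ≤ x → x ≤ z → σ * (x - A) ≤ z - A → (w x : ℝ) = A + σ * (x - A) :=
    fun x h1 h2 h3 => apply_eq_of_commute hz hl hl1 hfz (hcomm _ hw _ hf) hwσ
      (h.fix_left hw) h1 h2 hσ.le h3
  have hwB : ∀ x : UI, x ≤ B → reflection y ≤ x → w x ≤ B → reflection y ≤ w x →
      (w x : ℝ) = B + ν * (x - B) := by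
    intro x h1 h2 h3 h4
    have := apply_eq_of_commute' hy hn hn1 hey
      ((hcomm _ hw _ he).map PingPong.flip) hwν.flip (hfix' w hw) (x := reflection x)
      (reflection_le.2 h1) (by rwa [← reflection_le, reflection_reflection])
      (by rw [flip_apply_reflection]; exact reflection_le.2 h3)
      (by rw [flip_apply_reflection]; rwa [← reflection_le, reflection_reflection])
    rw [flip_apply_reflection, coe_reflection, coe_reflection, coe_reflection] at this
    linarith
  have hkB : ∀ x : UI, u ≤ x → x ≤ v → (w x : UI) ≤ v → x < w x →
      (k (w x) : ℝ) = B + ν * (k x - B) ∧ (k (w x) : ℝ) = k u + κ * (w x - u) ∧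
        (k x : ℝ) = k u + κ * (x - u) := by
    intro x h1 h2 h3 h4
    have h5 : reflection y ≤ k x := hku.le.trans ((h.isOPH hk) h1)
    have h6 : w (k x) = k (w x) := congrArg (fun g : Homeo01 => g x) (hcomm w hw k hk).eq
    have hvB : v < B := hvz.trans hzB
    refine ⟨?_, hkv _ (h1.trans h4.le) h3, hkv _ h1 h2⟩
    rw [← h6]
    refine hwB (k x) (h.apply_lt hk (h2.trans_lt hvB)).le h5 ?_ ?_
    · rw [h6]; exact (h.apply_lt hk (h3.trans_lt hvB)).le
    · rw [h6]; exact h5.trans (hkm h4).le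
  have hx₂ : (u : ℝ) < A + (v - A) / σ := by
    have : (u - A : ℝ) < (v - A) / σ := by rw [lt_div_iff₀ hσ]; linarith
    linarith
  have hx₂' : (A : ℝ) + (v - A) / σ < v := by
    have : (v - A : ℝ) / σ < v - A := div_lt_self (by linarith) hσ1
    linarith
  let x : UI := ⟨A + (v - A) / σ, by linarith [A.2.1], by linarith [v.2.2]⟩
  have hx : (x : ℝ) = A + (v - A) / σ := rfl
  have hxσ : σ * (x - A) = v - A := by rw [hx]; field_simp; ring
  have hux : u < x := hx₂
  have hxv : x < v := hx₂'
  have wu := hwA u hAu.le (huv.trans hvz).le (by linarith)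
  have wx := hwA x (hAu.trans hux).le (hxv.trans hvz).le (by linarith)
  obtain ⟨a1, a2, -⟩ := hkB u le_rfl huv.le
    (by rw [← Subtype.coe_le_coe, wu]; linarith)
    (by rw [← Subtype.coe_lt_coe, wu]; nlinarith)
  obtain ⟨b1, b2, b3⟩ := hkB x hux.le hxv.le
    (by rw [← Subtype.coe_le_coe, wx]; linarith)
    (by rw [← Subtype.coe_lt_coe, wx, hxσ, add_sub_cancel]; exact hxv)
  have hux' : (u : ℝ) < x := hux
  have key : κ * (x - u) * σ = κ * (x - u) * ν := by
    rw [wu] at a2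
    rw [wx] at b2
    have : (k (w x) : ℝ) - k (w u) = ν * (k x - k u) := by rw [a1, b1]; ring
    rw [a2, b2, b3] at this
    linarith
  have hne : κ * (x - u : ℝ) ≠ 0 := by
    have : (0 : ℝ) < x - u := by linarith
    positivity
  have hσν := mul_left_cancel₀ hne key
  have hkuB : (k u : ℝ) < B := h.apply_lt hk ((huv.trans hvz).trans hzB)
  have : (k u : ℝ) < k (w u) := hkm (by rw [← Subtype.coe_lt_coe, wu]; nlinarith)
  rw [a1, ← hσν] at this
  nlinarith

lemma OneOrbital.containsF_of_dense {G : Subgroup Homeo01} {A B : UI} (h : OneOrbital G A B)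
    (hd : DenseSlopes G A) : ContainsF G := by
  by_cases hc : ∃ c ∈ G, c ≠ 1 ∧ HasRightSlope c A 1
  · obtain ⟨c, hc, hc1, hcA⟩ := hc
    exact h.containsF_of_dense_of_ne hd hc hc1 hcA
  push Not at hc
  refine h.containsF_of_dense_of_commute hd fun g hg k hk => ?_
  by_contra hne
  obtain ⟨a, ha, hga⟩ := mem_PLG_slope (h.le_PLG hg) A
  obtain ⟨b, hb, hkb⟩ := mem_PLG_slope (h.le_PLG hk) A
  have hgk := G.mul_mem hg hk
  have hkg := G.mul_mem hk hg
  refine hc (g * k * (k * g)⁻¹) (G.mul_mem hgk (G.inv_mem hkg)) ?_ ?_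
  · rw [Ne, mul_inv_eq_one]
    exact hne
  · have := h.slope_mul (G.inv_mem hkg) (h.slope_inv hkg (by positivity) (h.slope_mul hg hga hkb))
      (h.slope_mul hk hkb hga)
    convert this using 1
    field_simp

/-- Without a copy of `F`, the slopes at the left end form a cyclic group. -/
lemma OneOrbital.exists_cyclic {G : Subgroup Homeo01} {A B : UI} (h : OneOrbital G A B)
    (hF : ¬ ContainsF G) :
    ∃ a : ℝ, ∀ g ∈ G, ∃ n : ℤ, HasRightSlope g A (Real.exp (n * a)) := by
  let L : AddSubgroup ℝ :=
    { carrier := {x | ∃ g ∈ G, HasRightSlope g A (Real.exp x)}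
      zero_mem' := ⟨1, G.one_mem, by rw [Real.exp_zero]; exact PingPong.hasRightSlope_one A⟩
      add_mem' := by
        rintro x y ⟨g, hg, h1⟩ ⟨k, hk, h2⟩
        exact ⟨g * k, G.mul_mem hg hk, by rw [Real.exp_add]; exact h.slope_mul hk h2 h1⟩
      neg_mem' := by
        rintro x ⟨g, hg, h1⟩
        exact ⟨g⁻¹, G.inv_mem hg, by
          rw [Real.exp_neg]; exact h.slope_inv hg (Real.exp_pos _) h1⟩ }
  rcases L.dense_or_cyclic with hL | ⟨a, ha⟩
  · refine absurd (h.containsF_of_dense fun u v hu huv => ?_) hF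
    obtain ⟨x, ⟨g, hg, hx⟩, h1, h2⟩ := hL.exists_between (Real.log_lt_log hu huv)
    refine ⟨g, hg, _, (Real.log_lt_iff_lt_exp hu).1 h1, ?_, hx⟩
    rw [← Real.exp_log (hu.trans huv)]
    exact Real.exp_lt_exp.2 h2
  · refine ⟨a, fun g hg => ?_⟩
    obtain ⟨c, hc, hgc⟩ := mem_PLG_slope (h.le_PLG hg) A
    have : Real.log c ∈ L := ⟨g, hg, by rwa [Real.exp_log hc]⟩
    rw [ha, AddSubgroup.mem_closure_singleton] at this
    obtain ⟨n, hn⟩ := this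
    refine ⟨n, ?_⟩
    rwa [← zsmul_eq_mul, hn, Real.exp_log hc]

/-! ### Changing generating families -/

section Nielsen
variable {ι Γ : Type*} [DecidableEq ι] [Group Γ]

lemma closure_range_update (Y : ι → Γ) (j : ι) {u v : Γ}
    (hu : u ∈ Subgroup.closure (Y '' {j}ᶜ)) (hv : v ∈ Subgroup.closure (Y '' {j}ᶜ)) :
    Subgroup.closure (range (Function.update Y j (u * Y j * v))) = Subgroup.closure (range Y) := by
  set Z := Function.update Y j (u * Y j * v) with hZ
  have hZj : Z j = u * Y j * v := Function.update_self ..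
  have hZi : ∀ i, i ≠ j → Z i = Y i := fun i hi => Function.update_of_ne hi ..
  have h1 : Subgroup.closure (Y '' {j}ᶜ) ≤ Subgroup.closure (range Y) :=
    Subgroup.closure_mono (image_subset_range _ _)
  have h2 : Subgroup.closure (Y '' {j}ᶜ) ≤ Subgroup.closure (range Z) := by
    apply Subgroup.closure_mono
    rintro _ ⟨i, hi, rfl⟩
    exact ⟨i, hZi i hi⟩
  apply le_antisymm
  · rw [Subgroup.closure_le]
    rintro _ ⟨i, rfl⟩
    by_cases hi : i = j
    · subst hi
      rw [hZj]
      exact mul_mem (mul_mem (h1 hu) (Subgroup.subset_closure ⟨i, rfl⟩)) (h1 hv)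
    · rw [hZi i hi]
      exact Subgroup.subset_closure ⟨i, rfl⟩
  · rw [Subgroup.closure_le]
    rintro _ ⟨i, rfl⟩
    by_cases hi : i = j
    · subst hi
      have e : Y i = u⁻¹ * Z i * v⁻¹ := by rw [hZj]; group
      rw [e]
      exact mul_mem (mul_mem (inv_mem (h2 hu)) (Subgroup.subset_closure ⟨i, rfl⟩)) (inv_mem (h2 hv))
    · rw [← hZi i hi]
      exact Subgroup.subset_closure ⟨i, rfl⟩

/-- The Euclidean algorithm on generating families. -/
lemma exists_generators_exponent [Fintype ι] (R : Γ → ℤ → Prop)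
    (hmul : ∀ g k a b, R g a → R k b → R (g * k) (a + b)) (hinv : ∀ g a, R g a → R g⁻¹ (-a)) :
    ∀ (N : ℕ) (Y : ι → Γ) (e : ι → ℤ), (∀ i, R (Y i) (e i)) → ∑ i, (e i).natAbs = N →
      ∃ (Y' : ι → Γ) (e' : ι → ℤ), Subgroup.closure (range Y') = Subgroup.closure (range Y) ∧
        (∀ i, R (Y' i) (e' i)) ∧ ∀ i j, i ≠ j → e' i = 0 ∨ e' j = 0 := by
  intro N
  induction N using Nat.strong_induction_on with
  | _ N ih =>
  intro Y e hR hN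
  by_cases hdone : ∀ i j, i ≠ j → e i = 0 ∨ e j = 0
  · exact ⟨Y, e, rfl, hR, hdone⟩
  push Not at hdone
  obtain ⟨i, j, hij, hi, hj, hle⟩ : ∃ i j, i ≠ j ∧ e i ≠ 0 ∧ e j ≠ 0 ∧ |e i| ≤ |e j| := by
    obtain ⟨i, j, hij, hi, hj⟩ := hdone
    rcases le_total |e i| |e j| with h | h
    · exact ⟨i, j, hij, hi, hj, h⟩
    · exact ⟨j, i, hij.symm, hj, hi, h⟩
  have hYi : Y i ∈ Subgroup.closure (Y '' {j}ᶜ) := Subgroup.subset_closure ⟨i, hij, rfl⟩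
  obtain ⟨v, a, hv, hva, hlt⟩ : ∃ v a, v ∈ Subgroup.closure (Y '' {j}ᶜ) ∧ R v a ∧
      (e j + a).natAbs < (e j).natAbs := by
    by_cases h : (e j + e i).natAbs < (e j).natAbs
    · exact ⟨Y i, e i, hYi, hR i, h⟩
    · refine ⟨(Y i)⁻¹, -e i, inv_mem hYi, hinv _ _ (hR i), ?_⟩
      rw [Int.abs_eq_natAbs, Int.abs_eq_natAbs] at hle
      omega
  have hR' : ∀ k, R (Function.update Y j (1 * Y j * v) k) (Function.update e j (e j + a) k) := by
    intro k
    by_cases hk : k = j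
    · subst hk
      rw [Function.update_self, Function.update_self, one_mul]
      exact hmul _ _ _ _ (hR k) hva
    · rw [Function.update_of_ne hk, Function.update_of_ne hk]
      exact hR k
  have hsum : ∑ k, (Function.update e j (e j + a) k).natAbs < N := by
    rw [← hN]
    refine Finset.sum_lt_sum (fun k _ => ?_) ⟨j, Finset.mem_univ j, ?_⟩
    · by_cases hk : k = j
      · subst hk
        rw [Function.update_self]
        exact hlt.le
      · rw [Function.update_of_ne hk]
    · rw [Function.update_self]
      exact hlt
  obtain ⟨Y', e', h1, h2, h3⟩ := ih _ hsum _ _ hR' rfl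
  exact ⟨Y', e', h1.trans (closure_range_update Y j (one_mem _) hv), h2, h3⟩

end Nielsen

/-! ### Boundary points of supports -/

/-- The boundary points of the support. -/
def bdry (g : Homeo01) : Set UI := closure (supt g) \ supt g

lemma IsTransition.mem_bdry {g : Homeo01} {t : UI} (h : IsTransition g t) : t ∈ bdry g := by
  rcases h with ⟨h1, h2⟩ | ⟨h1, h2⟩
  · refine ⟨Metric.mem_closure_iff.2 fun ε hε => ?_, h1⟩
    obtain ⟨s, hs, h3, h4⟩ := h2 ε hε
    refine ⟨s, hs, ?_⟩
    have : (t : ℝ) < s := h3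
    rw [Subtype.dist_eq, Real.dist_eq, abs_lt]
    constructor <;> linarith
  · refine ⟨Metric.mem_closure_iff.2 fun ε hε => ?_, h1⟩
    obtain ⟨s, hs, h3, h4⟩ := h2 ε hε
    refine ⟨s, hs, ?_⟩
    have : (s : ℝ) < t := h3
    rw [Subtype.dist_eq, Real.dist_eq, abs_lt]
    constructor <;> linarith

lemma apply_of_mem_bdry {g : Homeo01} {t : UI} (h : t ∈ bdry g) : g t = t := by
  simpa [supt] using h.2

lemma inv_apply_mem_bdry {g w : Homeo01} (hw : IsOPH w) {t : UI} (h : t ∈ bdry (w * g * w⁻¹)) :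
    w⁻¹ t ∈ bdry g := by
  have hmem : ∀ s, s ∈ supt (w * g * w⁻¹) ↔ w⁻¹ s ∈ supt g := by
    intro s
    change w (g (w⁻¹ s)) ≠ s ↔ g (w⁻¹ s) ≠ w⁻¹ s
    rw [not_iff_not]
    constructor
    · intro e
      apply w.injective
      rw [e, apply_inv_apply]
    · intro e
      rw [e, apply_inv_apply]
  have hcont : Continuous (w⁻¹ : Homeo01) :=
    Monotone.continuous_of_surjective hw.inv (Equiv.surjective _)
  exact ⟨map_mem_closure hcont h.1 fun s hs => (hmem s).1 hs, fun hs => h.2 ((hmem t).2 hs)⟩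

lemma bdry_inter_subsingleton {g : Homeo01} {a c : ℝ} {x : UI} :
    (bdry g ∩ {s | ∀ᶠ r in 𝓝 s, (g r : ℝ) = a + c * (r - x)}).Subsingleton := by
  have hc : ∀ s ∈ bdry g ∩ {s | ∀ᶠ r in 𝓝 s, (g r : ℝ) = a + c * (r - x)}, c ≠ 1 := by
    rintro s ⟨hs, hev⟩ rfl
    have h1 : (g s : ℝ) = a + 1 * (s - x) :=
      Eventually.self_of_nhds (p := fun r : UI => (g r : ℝ) = a + 1 * (r - x)) hev
    rw [apply_of_mem_bdry hs] at h1
    have h2 : ∃ᶠ r in 𝓝 s, r ∈ supt g := mem_closure_iff_frequently.1 hs.1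
    obtain ⟨r, h3, h4⟩ := (h2.and_eventually hev).exists
    exact h3 (Subtype.ext (by rw [h4]; linarith))
  intro s hs t ht
  have h1 : (g s : ℝ) = a + c * (s - x) :=
    Eventually.self_of_nhds (p := fun r : UI => (g r : ℝ) = a + c * (r - x)) hs.2
  have h2 : (g t : ℝ) = a + c * (t - x) :=
    Eventually.self_of_nhds (p := fun r : UI => (g r : ℝ) = a + c * (r - x)) ht.2
  rw [apply_of_mem_bdry hs.1] at h1
  rw [apply_of_mem_bdry ht.1] at h2
  have h3 : (1 - c) ≠ 0 := sub_ne_zero.2 (hc s hs).symm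
  apply Subtype.ext
  apply mul_left_cancel₀ h3
  linarith

lemma finite_bdry {g : Homeo01} (hg : g ∈ PLG) : (bdry g).Finite := by
  have : (bdry g ∩ univ).Finite := by
    refine isCompact_univ.induction_on (p := fun s => (bdry g ∩ s).Finite) (by simp)
      (fun s t hst ht => ht.subset (inter_subset_inter_right _ hst))
      (fun s t hs ht => by rw [inter_union_distrib_left]; exact hs.union ht) fun x _ => ?_
    obtain ⟨⟨c, -, h1⟩, d, -, h2⟩ := hg.2 x
    set P := {s | ∀ᶠ r in 𝓝 s, (g r : ℝ) = g x + c * (r - x)}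
    set Q := {s | ∀ᶠ r in 𝓝 s, (g r : ℝ) = g x + d * (r - x)}
    have hP : P ∈ 𝓝[>] x := by
      have := eventually_eventually_nhdsWithin.2 (h1.filter_mono (nhdsWithin_mono x Ioi_subset_Ici_self))
      filter_upwards [this, self_mem_nhdsWithin] with s hs hxs
      rwa [isOpen_Ioi.nhdsWithin_eq hxs] at hs
    have hQ : Q ∈ 𝓝[<] x := by
      have := eventually_eventually_nhdsWithin.2 (h2.filter_mono (nhdsWithin_mono x Iio_subset_Iic_self))
      filter_upwards [this, self_mem_nhdsWithin] with s hs hxs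
      rwa [isOpen_Iio.nhdsWithin_eq hxs] at hs
    refine ⟨insert x (Q ∪ P), ?_, ?_⟩
    · rw [nhdsWithin_univ, insert_mem_nhds_iff, ← nhdsLT_sup_nhdsGT]
      exact union_mem_sup hQ hP
    · refine Finite.subset ((finite_singleton x).union
        ((bdry_inter_subsingleton (g := g) (a := g x) (c := d) (x := x)).finite.union
          (bdry_inter_subsingleton (g := g) (a := g x) (c := c) (x := x)).finite)) ?_
      rintro s ⟨hs, rfl | hsQ | hsP⟩
      · exact Or.inl rfl
      · exact Or.inr (Or.inl ⟨hs, hsQ⟩)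
      · exact Or.inr (Or.inr ⟨hs, hsP⟩)
  rwa [inter_univ] at this

/-! ### Moving finite sets apart -/

lemma IsOPH.apply_of_pow_apply {g : Homeo01} (hg : IsOPH g) {p : UI} {n : ℕ} (hn : n ≠ 0)
    (h : (g ^ n) p = p) : g p = p := by
  by_contra hne
  obtain ⟨m, rfl⟩ := Nat.exists_eq_succ_of_ne_zero hn
  rcases lt_or_gt_of_ne hne with h1 | h1
  · have : ∀ m : ℕ, (g ^ (m + 1)) p < p := by
      intro m
      induction m with
      | zero => simpa using h1
      | succ m ih =>
        rw [pow_succ', Equiv.Perm.mul_apply]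
        exact (hg.strictMono ih).trans h1
    exact (this m).ne h
  · have : ∀ m : ℕ, p < (g ^ (m + 1)) p := by
      intro m
      induction m with
      | zero => simpa using h1
      | succ m ih =>
        rw [pow_succ', Equiv.Perm.mul_apply]
        exact h1.trans (hg.strictMono ih)
    exact (this m).ne' h

/-- A finite set of points without fixed points can be moved off any finite set
(B. H. Neumann). -/
lemma exists_forall_apply_notMem {K : Subgroup Homeo01} (hK : ∀ k ∈ K, IsOPH k) {P F : Set UI}
    (hP : P.Finite) (hF : F.Finite) (hmove : ∀ p ∈ P, ∃ k ∈ K, k p ≠ p) :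
    ∃ w ∈ K, ∀ p ∈ P, w p ∉ F := by
  classical
  by_contra! hcon
  let γ : UI × UI → K := fun pq =>
    if h : ∃ w : K, (w : Homeo01) pq.1 = pq.2 then h.choose else 1
  have hcover : ⋃ pq ∈ hP.toFinset ×ˢ hF.toFinset,
      γ pq • (MulAction.stabilizer K pq.1 : Set K) = univ := by
    rw [eq_univ_iff_forall]
    intro w
    obtain ⟨p, hp, hq⟩ := hcon w w.2
    simp only [mem_iUnion]
    refine ⟨(p, (w : Homeo01) p), by simp [hp, hq], ?_⟩
    have hex : ∃ w' : K, (w' : Homeo01) p = (w : Homeo01) p := ⟨w, rfl⟩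
    have hγ : ((γ (p, (w : Homeo01) p) : K) : Homeo01) p = (w : Homeo01) p := by
      simp only [γ, dif_pos hex]
      exact hex.choose_spec
    rw [mem_leftCoset_iff, SetLike.mem_coe, MulAction.mem_stabilizer_iff, mul_smul, inv_smul_eq_iff]
    exact hγ.symm
  obtain ⟨⟨p, q⟩, hpq, hfin⟩ := Subgroup.exists_finiteIndex_of_leftCoset_cover hcover
  have hp : p ∈ P := by
    have := (Finset.mem_product.1 hpq).1
    simpa using this
  obtain ⟨k, hk, hkp⟩ := hmove p hp
  obtain ⟨n, hn, -, hmem⟩ := Subgroup.exists_pow_mem_of_index_ne_zero hfin.index_ne_zero (⟨k, hk⟩ : K)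
  exact hkp ((hK k hk).apply_of_pow_apply hn.ne' hmem)

/-! ### Separating the transition points -/

section Separation
variable {ι : Type*} [Finite ι] {G : Subgroup Homeo01} {A B : UI}

lemma OneOrbital.exists_disjoint_bdry (h : OneOrbital G A B) (s : ι → ℝ) (Y : ι → Homeo01)
    (hY : Subgroup.closure (range Y) = G) (hs : ∀ i, HasRightSlope (Y i) A (s i)) (S : Finset ι) :
    ∃ Y' : ι → Homeo01, Subgroup.closure (range Y') = G ∧
      (∀ i, HasRightSlope (Y' i) A (s i)) ∧
      ∀ i ∈ S, ∀ j ≠ i, Disjoint (bdry (Y' i) ∩ Ioo A B) (bdry (Y' j)) := by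
  classical
  induction S using Finset.induction_on with
  | empty => exact ⟨Y, hY, hs, by simp⟩
  | insert i S _ ih =>
    clear hY hs Y
    obtain ⟨Y, hY, hs, hd⟩ := ih
    have hYG : ∀ j, Y j ∈ G := fun j => hY ▸ Subgroup.subset_closure ⟨j, rfl⟩
    have hKG : Subgroup.closure (Y '' {i}ᶜ) ≤ G := by
      rw [← hY]
      exact Subgroup.closure_mono (image_subset_range _ _)
    have hmove : ∀ p ∈ bdry (Y i) ∩ Ioo A B, ∃ k ∈ Subgroup.closure (Y '' {i}ᶜ), k p ≠ p := by
      rintro p ⟨hp, hA, hB⟩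
      by_contra! hcon
      obtain ⟨g, hg, hne⟩ := h.move p hA hB
      have hle : G ≤ MulAction.stabilizer Homeo01 p := by
        rw [← hY, Subgroup.closure_le]
        rintro _ ⟨j, rfl⟩
        by_cases hj : j = i
        · subst hj
          exact apply_of_mem_bdry hp
        · exact hcon _ (Subgroup.subset_closure ⟨j, hj, rfl⟩)
      exact hne (hle hg)
    obtain ⟨w, hw, hwP⟩ := exists_forall_apply_notMem (fun k hk => h.isOPH (hKG hk))
      ((finite_bdry (h.le_PLG (hYG i))).inter_of_left (Ioo A B))
      (finite_iUnion fun j => finite_bdry (h.le_PLG (hYG j))) hmove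
    have hwG := hKG hw
    set Z := Function.update Y i (w * Y i * w⁻¹) with hZ
    have hZi : Z i = w * Y i * w⁻¹ := Function.update_self ..
    have hZj : ∀ j, j ≠ i → Z j = Y j := fun j hj => Function.update_of_ne hj ..
    have hdi : ∀ j ≠ i, ∀ t ∈ Ioo A B, t ∈ bdry (Z i) → t ∉ bdry (Z j) := by
      intro j hj t ht hti htj
      rw [hZi] at hti
      rw [hZj j hj] at htj
      refine hwP (w⁻¹ t) ⟨inv_apply_mem_bdry (h.isOPH hwG) hti,
        h.lt_apply (G.inv_mem hwG) ht.1, h.apply_lt (G.inv_mem hwG) ht.2⟩ ?_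
      rw [apply_inv_apply]
      exact mem_iUnion.2 ⟨j, htj⟩
    refine ⟨Z, ?_, fun j => ?_, fun k hk j hjk => Set.disjoint_left.2 ?_⟩
    · rw [hZ, closure_range_update Y i hw (inv_mem hw), hY]
    · by_cases hj : j = i
      · subst hj
        have := hasRightSlope_conj (h.isOPH (hYG j)) (h.le_PLG hwG) (hs j) (h.fix_left (hYG j))
        rwa [h.fix_left hwG, ← hZi] at this
      · rw [hZj j hj]
        exact hs j
    · rintro t ⟨htk, ht⟩ htj
      by_cases hki : k = i
      · subst hki
        exact hdi j hjk t ht htk htj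
      · by_cases hji : j = i
        · subst hji
          exact hdi k hki t ht htj htk
        · rw [hZj k hki] at htk
          rw [hZj j hji] at htj
          exact Set.disjoint_left.1 (hd k ((Finset.mem_insert.1 hk).resolve_left hki) j hjk)
            ⟨htk, ht⟩ htj

end Separation

/-! ### Geometrically proper generating families -/

lemma OneOrbital.mem_Ico_of_isLeftTransition {G : Subgroup Homeo01} {A B : UI}
    (h : OneOrbital G A B) {g : Homeo01} (hg : g ∈ G) {t : UI} (ht : IsLeftTransition g t) :
    t ∈ Ico A B := by
  by_contra hc
  rw [mem_Ico, not_and_or, not_le, not_lt] at hc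
  rcases hc with hc | hc
  · obtain ⟨s, hs, h1, h2⟩ := ht.2 (A - t) (sub_pos.2 hc)
    refine hs (h.fix g hg s fun h3 => ?_)
    have : (A : ℝ) < s := h3.1
    linarith
  · obtain ⟨s, hs, h1, -⟩ := ht.2 1 one_pos
    exact hs (h.fix g hg s fun h3 => (hc.trans_lt h1).not_gt h3.2)

lemma OneOrbital.mem_Ioc_of_isRightTransition {G : Subgroup Homeo01} {A B : UI}
    (h : OneOrbital G A B) {g : Homeo01} (hg : g ∈ G) {t : UI} (ht : IsRightTransition g t) :
    t ∈ Ioc A B := by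
  by_contra hc
  rw [mem_Ioc, not_and_or, not_le, not_lt] at hc
  rcases hc with hc | hc
  · obtain ⟨s, hs, h1, -⟩ := ht.2 1 one_pos
    exact hs (h.fix g hg s fun h3 => (h1.trans_le hc).not_gt h3.1)
  · obtain ⟨s, hs, h1, h2⟩ := ht.2 (t - B) (sub_pos.2 hc)
    refine hs (h.fix g hg s fun h3 => ?_)
    have : (s : ℝ) < B := h3.2
    linarith

lemma HasRightSlope.not_isLeftTransition {g : Homeo01} {p b : UI} (h : HasRightSlope g p 1)
    (hp : g p = p) (hb : p < b) : ¬ IsLeftTransition g p := by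
  intro ht
  obtain ⟨z, h1, -, h2⟩ := h.exists_linOn hp hb
  obtain ⟨s, hs, h3, h4⟩ := ht.2 (z - p) (sub_pos.2 h1)
  refine hs (Subtype.ext ?_)
  rw [h2 s h3.le (by rw [← Subtype.coe_le_coe]; linarith)]
  ring

lemma HasLeftSlope.not_isRightTransition {g : Homeo01} {a b : UI} (h : HasLeftSlope g b 1)
    (hb : g b = b) (ha : a < b) : ¬ IsRightTransition g b := by
  intro ht
  obtain ⟨q, -, h1, h2⟩ := h.exists_forall_ge hb ha
  obtain ⟨s, hs, h3, h4⟩ := ht.2 (b - q) (sub_pos.2 h1)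
  exact hs (h2 s (by rw [← Subtype.coe_le_coe]; linarith) h3.le)

lemma OneOrbital.exists_geomProper {ι : Type*} [Fintype ι] {G : Subgroup Homeo01} {A B : UI}
    (h : OneOrbital G A B) (hF : ¬ ContainsF G) (f : ι → Homeo01)
    (hf : Subgroup.closure (range f) = G) :
    ∃ Y : ι → Homeo01, GeomProper (range Y) ∧ Subgroup.closure (range Y) = G := by
  classical
  obtain ⟨a, ha⟩ := h.exists_cyclic hF
  have hfG : ∀ i, f i ∈ G := fun i => hf ▸ Subgroup.subset_closure ⟨i, rfl⟩
  choose e he using fun i => ha (f i) (hfG i)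
  obtain ⟨Y₀, e', hY₀, hR, h0⟩ := exists_generators_exponent
    (fun g n => g ∈ G ∧ HasRightSlope g A (Real.exp ((n : ℤ) * a)))
    (fun g k m n hg hk => ⟨G.mul_mem hg.1 hk.1, by
      rw [Int.cast_add, add_mul, Real.exp_add]; exact h.slope_mul hk.1 hk.2 hg.2⟩)
    (fun g m hg => ⟨G.inv_mem hg.1, by
      rw [Int.cast_neg, neg_mul, Real.exp_neg]; exact h.slope_inv hg.1 (Real.exp_pos _) hg.2⟩)
    _ f e (fun i => ⟨hfG i, he i⟩) rfl
  obtain ⟨Y, hY, hs, hd⟩ := h.exists_disjoint_bdry _ Y₀ (hY₀.trans hf) (fun i => (hR i).2)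
    Finset.univ
  have hYG : ∀ i, Y i ∈ G := fun i => hY ▸ Subgroup.subset_closure ⟨i, rfl⟩
  have hone : ∀ i, e' i = 0 → HasRightSlope (Y i) A 1 := by
    intro i hi
    have := hs i
    rwa [hi, Int.cast_zero, zero_mul, Real.exp_zero] at this
  have hinner : ∀ i j, i ≠ j → ∀ t ∈ Ioo A B, IsTransition (Y i) t → ¬ IsTransition (Y j) t :=
    fun i j hij t ht hi hj => Set.disjoint_left.1 (hd i (Finset.mem_univ i) j hij.symm)
      ⟨hi.mem_bdry, ht⟩ hj.mem_bdry
  refine ⟨Y, ⟨?_, ?_⟩, hY⟩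
  · rintro _ ⟨i, rfl⟩ _ ⟨j, rfl⟩ hne t ⟨hi, hj⟩
    have hij : i ≠ j := fun e => hne (e ▸ rfl)
    obtain ⟨h1, h2⟩ := h.mem_Ico_of_isLeftTransition (hYG i) hi
    rcases h1.eq_or_lt with rfl | h1
    · rcases h0 i j hij with h3 | h3
      · exact (hone i h3).not_isLeftTransition (h.fix_left (hYG i)) h2 hi
      · exact (hone j h3).not_isLeftTransition (h.fix_left (hYG j)) h2 hj
    · exact hinner i j hij t ⟨h1, h2⟩ (Or.inl hi) (Or.inl hj)
  · rintro _ ⟨i, rfl⟩ _ ⟨j, rfl⟩ hne t ⟨hi, hj⟩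
    have hij : i ≠ j := fun e => hne (e ▸ rfl)
    obtain ⟨h1, h2⟩ := h.mem_Ioc_of_isRightTransition (hYG i) hi
    rcases h2.eq_or_lt with rfl | h2
    · rcases h0 i j hij with h3 | h3
      · exact (h.hasLeftSlope_one hF (hYG i) (hone i h3)).not_isRightTransition
          (h.fix_right (hYG i)) h1 hi
      · exact (h.hasLeftSlope_one hF (hYG j) (hone j h3)).not_isRightTransition
          (h.fix_right (hYG j)) h1 hj
    · exact hinner i j hij t ⟨h1, h2⟩ (Or.inr hi) (Or.inr hj)

lemma exists_oneOrbital {G : Subgroup Homeo01} (hG : G ≤ PLG) {a b : ℝ}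
    (h : {t : UI | ∃ g ∈ G, g t ≠ t} = {t : UI | a < t ∧ (t : ℝ) < b}) :
    (∀ g ∈ G, g = 1) ∨ ∃ A B, OneOrbital G A B := by
  by_cases hne : ∃ g ∈ G, g ≠ 1
  swap
  · push Not at hne
    exact Or.inl hne
  right
  obtain ⟨g, hg, hg1⟩ := hne
  obtain ⟨t, ht⟩ := not_forall.1 fun hc => hg1 (Equiv.ext hc)
  have key : ∀ t : UI, (∃ g ∈ G, g t ≠ t) ↔ a < t ∧ (t : ℝ) < b := fun t => Set.ext_iff.1 h t
  obtain ⟨h1, h2⟩ := (key t).1 ⟨g, hg, ht⟩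
  have ha : 0 ≤ a := by
    by_contra! ha
    obtain ⟨k, hk, hk0⟩ := (key 0).2 ⟨ha, by simpa using t.2.1.trans_lt h2⟩
    exact hk0 (Subtype.ext (coe_apply_zero (hG hk).1))
  have hb : b ≤ 1 := by
    by_contra! hb
    obtain ⟨k, hk, hk0⟩ := (key 1).2 ⟨by simpa using h1.trans_le t.2.2, hb⟩
    exact hk0 (Subtype.ext (coe_apply_one (hG hk).1))
  refine ⟨⟨a, ha, (h1.trans_le t.2.2).le⟩, ⟨b, (t.2.1.trans_lt h2).le, hb⟩, hG, ?_, ?_, ?_⟩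
  · exact Subtype.coe_lt_coe.1 (h1.trans h2)
  · exact fun s hs1 hs2 => (key s).2 ⟨hs1, hs2⟩
  · intro k hk s hs
    by_contra hks
    exact hs ((key s).1 ⟨k, hk, hks⟩)

end PingPong
namespace PingPong

/-- **Theorem (GeoProperGen).** Every `n`-generated one-orbital subgroup of
`PL₊(I)` either contains an isomorphic copy of Thompson's group `F` or admits an
`n`-element geometrically proper generating set. -/
theorem geo_proper_gen (n : ℕ) (f : Fin n → Homeo01)
    (hf : ∀ i, IsOPH (f i) ∧ IsPL (f i))
    (horb : ∃ a b : ℝ, a < b ∧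
      {t : UI | ∃ g ∈ Subgroup.closure (Set.range f), g t ≠ t}
        = {t : UI | a < (t : ℝ) ∧ (t : ℝ) < b}) :
    (∃ φ : Homeo01 → Homeo01,
      Set.InjOn φ {g | InThompsonF g} ∧
      (∀ g : Homeo01, InThompsonF g → φ g ∈ Subgroup.closure (Set.range f)) ∧
      (∀ g h : Homeo01, InThompsonF g → InThompsonF h → φ (g * h) = φ g * φ h)) ∨
    (∃ Y : Fin n → Homeo01, GeomProper (Set.range Y) ∧
      Subgroup.closure (Set.range Y) = Subgroup.closure (Set.range f)) := by
  by_cases hF : ContainsF (Subgroup.closure (Set.range f))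
  · exact Or.inl hF
  right
  obtain ⟨a, b, -, horb⟩ := horb
  have hG : Subgroup.closure (Set.range f) ≤ PLG := by
    rw [Subgroup.closure_le]
    rintro _ ⟨i, rfl⟩
    exact IsPL.mem_PLG (hf i).1 (hf i).2
  rcases exists_oneOrbital hG horb with h1 | ⟨A, B, h⟩
  · have hf1 : ∀ i, f i = 1 := fun i => h1 _ (Subgroup.subset_closure ⟨i, rfl⟩)
    refine ⟨f, ⟨?_, ?_⟩, rfl⟩ <;>
    · rintro _ ⟨i, rfl⟩ _ ⟨j, rfl⟩ hne
      exact absurd ((hf1 i).trans (hf1 j).symm) hne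
  · exact h.exists_geomProper hF f rfl

end PingPong
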